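/- arXiv:1508.01500 — 2 statements merged into one kernel-verified Lean document; each statement's English description precedes it below -/
import Mathlib

section
/- Let α ≠ 0, let N ≥ 1 be an integer, u₀ ∈ ℒ(N), and let u be the solution of the α-Szegő equation with u(0) = u₀. Suppose t_n → ∞ and u(t_n) converges weakly in H^{1/2}₊ to some u^∞. If rank K_{u^∞} < rank K_{u₀}, then there exists σ_k ∈ Σ_K(u₀) such that ℓ_k(u₀) := ‖u'_k‖² − α‖v'_k‖² = 0, where u'_k and v'_k are the orthogonal projections of u₀ and of the constant function 1 onto F_{u₀}(σ_k). -/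
open Complex Filter
open scoped ComplexConjugate Topology ENNReal

noncomputable section

/-- ℓ²(ℕ, ℂ): the sequence model of the Hardy space L²₊(S¹), identifying a function
with its sequence of nonnegative Fourier coefficients. -/
abbrev Hardy : Type := lp (fun _ : ℕ => ℂ) 2

/-- A coefficient sequence belongs to L²₊. -/
def MemL2 (u : ℕ → ℂ) : Prop := Memℓp u 2

/-- A coefficient sequence belongs to the Sobolev space H^s₊. -/
def MemHs (s : ℝ) (u : ℕ → ℂ) : Prop :=
  Summable fun n : ℕ => ((1 : ℝ) + (n : ℝ) ^ 2) ^ s * ‖u n‖ ^ 2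

/-- The squared H^s norm of a coefficient sequence. -/
def hsNormSq (s : ℝ) (u : ℕ → ℂ) : ℝ :=
  ∑' n : ℕ, ((1 : ℝ) + (n : ℝ) ^ 2) ^ s * ‖u n‖ ^ 2

/-- The L² inner product (f|g), ℂ-linear in the first argument. -/
def hinner (f g : ℕ → ℂ) : ℂ := ∑' n : ℕ, f n * conj (g n)

/-- The squared L² norm. -/
def l2normSq (f : ℕ → ℂ) : ℝ := ∑' n : ℕ, ‖f n‖ ^ 2

/-- Coefficients of the constant function 1. -/
def oneSeq : ℕ → ℂ := fun n => if n = 0 then 1 else 0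

/-- The Hankel operator H_u(h) = Π(u ⬝ conj h) in Fourier coefficients. -/
def hankel (u h : ℕ → ℂ) : ℕ → ℂ := fun k => ∑' ℓ : ℕ, u (k + ℓ) * conj (h ℓ)

/-- The shifted Hankel operator K_u = T_z^* ∘ H_u in Fourier coefficients. -/
def khankel (u h : ℕ → ℂ) : ℕ → ℂ := fun k => ∑' ℓ : ℕ, u (k + 1 + ℓ) * conj (h ℓ)

/-- H_u². -/
def hu2 (u h : ℕ → ℂ) : ℕ → ℂ := hankel u (hankel u h)

/-- K_u². -/
def ku2 (u h : ℕ → ℂ) : ℕ → ℂ := khankel u (khankel u h)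

/-- The m-th Fourier coefficient of |u|², m ∈ ℤ. -/
def absSqCoeff (u : ℕ → ℂ) (m : ℤ) : ℂ :=
  ∑' q : ℕ × ℕ, if ((q.1 : ℤ) - (q.2 : ℤ) = m) then u q.1 * conj (u q.2) else 0

/-- The Toeplitz operator T_{|u|²} in Fourier coefficients. -/
def toeplitzAbsSq (u h : ℕ → ℂ) : ℕ → ℂ :=
  fun k => ∑' ℓ : ℕ, absSqCoeff u ((k : ℤ) - (ℓ : ℤ)) * h ℓ

/-- Fourier coefficients of Π(|u|²u). -/
def cubic (u : ℕ → ℂ) : ℕ → ℂ := fun n =>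
  ∑' q : ℕ × ℕ × ℕ, if q.1 + q.2.2 = q.2.1 + n then u q.1 * conj (u q.2.1) * u q.2.2 else 0

/-- `u : ℝ → (ℕ → ℂ)` solves the α-Szegő equation i ∂ₜ u = Π(|u|²u) + α(u|1),
written coefficientwise on nonnegative Fourier modes. -/
def SolvesSzego (α : ℝ) (u : ℝ → ℕ → ℂ) : Prop :=
  ∀ n t, HasDerivAt (fun τ => u τ n)
    (-Complex.I * (cubic (u t) n + (α : ℂ) * u t 0 * oneSeq n)) t

/-- `u` is a smooth curve valued in H^s₊. -/
def SmoothHsCurve (s : ℝ) (u : ℝ → ℕ → ℂ) : Prop :=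
  (∀ t, MemHs s (u t)) ∧ ∀ n, ContDiff ℝ (⊤ : ℕ∞) fun t => u t n

/-- `u` is a continuous curve valued in H^s₊. -/
def ContHsCurve (s : ℝ) (u : ℝ → ℕ → ℂ) : Prop :=
  (∀ t, MemHs s (u t)) ∧
    ∀ t₀ : ℝ, Tendsto (fun t => hsNormSq s (fun n => u t n - u t₀ n)) (𝓝 t₀) (𝓝 0)

/-- E_u(τ) = ker(H_u² − τ² I) as a subset of ℓ². -/
def Espace (u : ℕ → ℂ) (τ : ℝ) : Set (ℕ → ℂ) :=
  {h | MemL2 h ∧ hu2 u h = ((τ : ℂ) ^ 2) • h}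

/-- F_u(τ) = ker(K_u² − τ² I) as a subset of ℓ². -/
def Fspace (u : ℕ → ℂ) (τ : ℝ) : Set (ℕ → ℂ) :=
  {h | MemL2 h ∧ ku2 u h = ((τ : ℂ) ^ 2) • h}

/-- Σ_H(u): τ > 0 such that E_u(τ) is not orthogonal to u. -/
def SigmaH (u : ℕ → ℂ) : Set ℝ :=
  {τ : ℝ | 0 < τ ∧ ∃ v ∈ Espace u τ, hinner u v ≠ 0}

/-- Σ_K(u): τ ≥ 0 such that F_u(τ) is not orthogonal to u. -/
def SigmaK (u : ℕ → ℂ) : Set ℝ :=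
  {τ : ℝ | 0 ≤ τ ∧ ∃ v ∈ Fspace u τ, hinner u v ≠ 0}

/-- `p` is the orthogonal projection of `w` on the subspace `V` of ℓ². -/
def IsOrthProj (V : Set (ℕ → ℂ)) (w p : ℕ → ℂ) : Prop :=
  p ∈ V ∧ ∀ v ∈ V, hinner (w - p) v = 0

/-- The rank of the shifted Hankel operator K_u. -/
def kuRank (u : ℕ → ℂ) : Cardinal :=
  Module.rank ℂ (Submodule.span ℂ (khankel u '' {h | MemL2 h}))

/-- The rank of the Hankel operator H_u. -/
def huRank (u : ℕ → ℂ) : Cardinal :=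
  Module.rank ℂ (Submodule.span ℂ (hankel u '' {h | MemL2 h}))

/-- ℒ(N) : rank K_u = N. -/
def InLN (N : ℕ) (u : ℕ → ℂ) : Prop := MemL2 u ∧ kuRank u = N

/-- The constant function 1 as an element of ℓ². -/
def oneH : Hardy := lp.single 2 0 1


/-- The H^{1/2} inner product, ℂ-linear in the first argument. -/
def h12inner (f g : ℕ → ℂ) : ℂ :=
  ∑' n : ℕ, ((((1 : ℝ) + (n : ℝ) ^ 2) ^ ((1 : ℝ) / 2) : ℝ) : ℂ) * (f n * conj (g n))

namespace Szego

/-- The Wiener algebra of absolutely summable coefficient sequences. -/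
abbrev Wiener : Type := lp (fun _ : ℕ => ℂ) 1

/-- Reindexing along an injective partial map is a contraction of `ℓᵖ`. -/
def partialShift (p : ℝ≥0∞) [Fact (1 ≤ p)] (φ : ℕ → Option ℕ)
    (hφ : ∀ i j k, φ i = some k → φ j = some k → i = j) :
    lp (fun _ : ℕ => ℂ) p →L[ℂ] lp (fun _ : ℕ => ℂ) p :=
  have key : ∀ (h : lp (fun _ : ℕ => ℂ) p) (_ : 0 < p.toReal) (s : Finset ℕ),
      ∑ i ∈ s, ‖(φ i).elim 0 h‖ ^ p.toReal ≤ ‖h‖ ^ p.toReal := by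
    intro h hp s
    classical
    have h1 : ∑ i ∈ s, ‖(φ i).elim 0 h‖ ^ p.toReal
        = ∑ i ∈ s with (φ i).isSome, ‖(φ i).elim 0 h‖ ^ p.toReal := by
      rw [Finset.sum_filter]
      refine Finset.sum_congr rfl fun i _ => ?_
      rcases hi : φ i with _ | k <;> simp [hp.ne']
    have h2 : ∑ i ∈ s with (φ i).isSome, ‖(φ i).elim 0 h‖ ^ p.toReal
        = ∑ k ∈ (s.filter fun i => (φ i).isSome).image (fun i => (φ i).getD 0),
            ‖h k‖ ^ p.toReal := by
      rw [Finset.sum_image]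
      · refine Finset.sum_congr rfl fun i hi => ?_
        obtain ⟨k, hk⟩ := Option.isSome_iff_exists.1 (Finset.mem_filter.1 hi).2
        simp [hk]
      · intro i hi j hj hij
        simp only [Finset.coe_filter, Set.mem_ofPred_eq] at hi hj
        obtain ⟨k, hk⟩ := Option.isSome_iff_exists.1 hi.2
        obtain ⟨l, hl⟩ := Option.isSome_iff_exists.1 hj.2
        simp only [hk, hl, Option.getD_some] at hij
        exact hφ i j k hk (hij ▸ hl)
    rw [h1, h2]
    exact lp.sum_rpow_le_norm_rpow hp h _
  have mem : ∀ h : lp (fun _ : ℕ => ℂ) p, Memℓp (fun i => (φ i).elim 0 h) p := by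
    intro h
    rcases p.trichotomy with rfl | rfl | hp
    · exact absurd (Fact.out : (1 : ℝ≥0∞) ≤ 0) (by simp)
    · refine memℓp_infty ⟨‖h‖, ?_⟩
      rintro _ ⟨i, rfl⟩
      rcases hi : φ i with _ | k
      · simp [hi]
      · simpa [hi] using lp.norm_apply_le_norm ENNReal.top_ne_zero h k
    · exact memℓp_gen' (key h hp)
  LinearMap.mkContinuous
    { toFun := fun h => ⟨fun i => (φ i).elim 0 h, mem h⟩
      map_add' := fun f g => by
        ext i
        change (φ i).elim 0 ⇑(f + g) = (φ i).elim 0 ⇑f + (φ i).elim 0 ⇑g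
        rcases hi : φ i with _ | k
        · exact (add_zero _).symm
        · rfl
      map_smul' := fun c f => by
        ext i
        change (φ i).elim 0 ⇑(c • f) = c * (φ i).elim 0 ⇑f
        rcases hi : φ i with _ | k
        · exact (mul_zero _).symm
        · rfl } 1 <| by
    intro h
    rw [one_mul]
    rcases p.trichotomy with rfl | rfl | hp
    · exact absurd (Fact.out : (1 : ℝ≥0∞) ≤ 0) (by simp)
    · refine lp.norm_le_of_forall_le (norm_nonneg _) fun i => ?_
      rcases hi : φ i with _ | k
      · simp [hi]
      · simpa [hi] using lp.norm_apply_le_norm ENNReal.top_ne_zero h k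
    · exact lp.norm_le_of_forall_sum_le hp (norm_nonneg _) (key h hp)

section partialShift

variable (p : ℝ≥0∞) [Fact (1 ≤ p)] (φ : ℕ → Option ℕ)
  (hφ : ∀ i j k, φ i = some k → φ j = some k → i = j)

theorem norm_partialShift_le : ‖partialShift p φ hφ‖ ≤ 1 := by
  unfold partialShift
  exact LinearMap.mkContinuous_norm_le _ zero_le_one _

/-- The shift `h ↦ z h`. -/
def shift : lp (fun _ : ℕ => ℂ) p →L[ℂ] lp (fun _ : ℕ => ℂ) p :=
  partialShift p (fun n => if n = 0 then none else some (n - 1)) <| by grind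

/-- The adjoint of the shift. -/
def bshift : lp (fun _ : ℕ => ℂ) p →L[ℂ] lp (fun _ : ℕ => ℂ) p :=
  partialShift p (fun n => some (n + 1)) <| by grind

/-- The linear reflection `h ↦ (h m, …, h 0, 0, …)`. -/
def reflect (m : ℕ) : lp (fun _ : ℕ => ℂ) p →L[ℂ] lp (fun _ : ℕ => ℂ) p :=
  partialShift p (fun n => if n ≤ m then some (m - n) else none) <| by grind

variable (h : lp (fun _ : ℕ => ℂ) p)

@[simp] theorem shift_zero : shift p h 0 = 0 := rfl

@[simp] theorem shift_succ (n : ℕ) : shift p h (n + 1) = h n := rfl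

@[simp] theorem bshift_apply (n : ℕ) : bshift p h n = h (n + 1) := rfl

theorem reflect_apply (m n : ℕ) : reflect p m h n = if n ≤ m then h (m - n) else 0 := by
  change (if n ≤ m then some (m - n) else none : Option ℕ).elim 0 ⇑h = _
  split_ifs <;> rfl

theorem shift_pow_apply (k n : ℕ) :
    (shift p ^ k) h n = if k ≤ n then h (n - k) else 0 := by
  induction k generalizing n with
  | zero => simp
  | succ k ih =>
    rw [pow_succ', mul_apply_eq_comp]
    cases n with
    | zero => simp
    | succ n => rw [shift_succ, ih]; simp

theorem bshift_pow_apply (k n : ℕ) : (bshift p ^ k) h n = h (n + k) := by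
  induction k generalizing n with
  | zero => simp
  | succ k ih =>
    rw [pow_succ', mul_apply_eq_comp, bshift_apply, ih]
    rw [add_assoc, Nat.add_comm 1 k]

theorem norm_pow_le_one {E : Type*} [NormedAddCommGroup E] [NormedSpace ℂ E] {A : E →L[ℂ] E}
    (hA : ‖A‖ ≤ 1) (n : ℕ) : ‖A ^ n‖ ≤ 1 := by
  induction n with
  | zero => exact ContinuousLinearMap.norm_id_le
  | succ n ih =>
    rw [pow_succ]
    exact (ContinuousLinearMap.opNorm_comp_le _ _).trans (mul_le_one₀ ih (norm_nonneg _) hA)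

theorem norm_shift_pow_le (n : ℕ) : ‖shift p ^ n‖ ≤ 1 :=
  norm_pow_le_one (norm_partialShift_le ..) n

theorem norm_bshift_pow_le (n : ℕ) : ‖bshift p ^ n‖ ≤ 1 :=
  norm_pow_le_one (norm_partialShift_le ..) n

end partialShift

theorem Wiener.summable_norm (u : Wiener) : Summable fun n => ‖u n‖ := by
  simpa using (lp.memℓp u).summable (by simp)

theorem Wiener.norm_eq (u : Wiener) : ‖u‖ = ∑' n, ‖u n‖ := by
  simpa using lp.norm_eq_tsum_rpow (p := 1) (by simp) u

section wsum

theorem summable_norm_smul {E : Type*} [NormedAddCommGroup E] [NormedSpace ℂ E]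
    (A : ℕ → E) (hA : ∀ n, ‖A n‖ ≤ 1) (u : Wiener) : Summable fun n => ‖u n • A n‖ := by
  refine Summable.of_nonneg_of_le (fun _ => norm_nonneg _) (fun n => ?_) u.summable_norm
  rw [norm_smul]
  exact mul_le_of_le_one_right (norm_nonneg _) (hA n)

variable {E : Type*} [NormedAddCommGroup E] [NormedSpace ℂ E] [CompleteSpace E]
  (A : ℕ → E) (hA : ∀ n, ‖A n‖ ≤ 1)

/-- The series `∑ uₙ Aₙ` for a bounded sequence `A`, as a linear map in `u ∈ ℓ¹`. -/
def wsum : Wiener →L[ℂ] E :=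
  LinearMap.mkContinuous
    { toFun := fun u => ∑' n, u n • A n
      map_add' := fun u v => by
        rw [← (summable_norm_smul A hA u).of_norm.tsum_add (summable_norm_smul A hA v).of_norm]
        simp [add_smul]
      map_smul' := fun c u => by
        rw [RingHom.id_apply, ← (summable_norm_smul A hA u).of_norm.tsum_const_smul]
        simp [mul_smul] } 1 <| by
    intro u
    rw [one_mul, u.norm_eq]
    refine (norm_tsum_le_tsum_norm (summable_norm_smul A hA u)).trans ?_
    refine (summable_norm_smul A hA u).tsum_le_tsum (fun n => ?_) u.summable_norm
    rw [norm_smul]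
    exact mul_le_of_le_one_right (norm_nonneg _) (hA n)

theorem hasSum_wsum (u : Wiener) : HasSum (fun n => u n • A n) (wsum A hA u) :=
  (summable_norm_smul A hA u).of_norm.hasSum

theorem norm_wsum_le (u : Wiener) : ‖wsum A hA u‖ ≤ ‖u‖ :=
  ((wsum A hA).le_of_opNorm_le (LinearMap.mkContinuous_norm_le _ zero_le_one _) u).trans_eq
    (one_mul _)

theorem hasSum_wsum_apply {F : Type*} [NormedAddCommGroup F] [NormedSpace ℂ F]
    [CompleteSpace F] (A : ℕ → F →L[ℂ] F) (hA : ∀ n, ‖A n‖ ≤ 1) (u : Wiener) (h : F) :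
    HasSum (fun n => u n • A n h) (wsum A hA u h) := by
  simpa using (ContinuousLinearMap.apply ℂ F h).hasSum (hasSum_wsum A hA u)

end wsum

section operators

variable (p : ℝ≥0∞) [Fact (1 ≤ p)]

/-- Multiplication by `u`. -/
def mulOp : Wiener →L[ℂ] lp (fun _ : ℕ => ℂ) p →L[ℂ] lp (fun _ : ℕ => ℂ) p :=
  wsum (fun n => shift p ^ n) (norm_shift_pow_le p)

/-- The Toeplitz operator with symbol `∑ uₙ z⁻ⁿ`. -/
def coMulOp : Wiener →L[ℂ] lp (fun _ : ℕ => ℂ) p →L[ℂ] lp (fun _ : ℕ => ℂ) p :=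
  wsum (fun n => bshift p ^ n) (norm_bshift_pow_le p)

/-- The linear Hankel operator with symbol `u`. -/
def hankelOp : Wiener →L[ℂ] lp (fun _ : ℕ => ℂ) p →L[ℂ] lp (fun _ : ℕ => ℂ) p :=
  wsum (reflect p) fun _ => norm_partialShift_le ..

variable (u : Wiener) (h : lp (fun _ : ℕ => ℂ) p)

theorem hasSum_mulOp : HasSum (fun n => u n • (shift p ^ n) h) (mulOp p u h) :=
  hasSum_wsum_apply _ (norm_shift_pow_le p) u h

theorem hasSum_coMulOp : HasSum (fun n => u n • (bshift p ^ n) h) (coMulOp p u h) :=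
  hasSum_wsum_apply _ (norm_bshift_pow_le p) u h

theorem hasSum_hankelOp : HasSum (fun n => u n • reflect p n h) (hankelOp p u h) :=
  hasSum_wsum_apply _ (fun _ => norm_partialShift_le ..) u h

theorem hasSum_lp_apply {f : ℕ → lp (fun _ : ℕ => ℂ) p} {g : lp (fun _ : ℕ => ℂ) p}
    (hf : HasSum f g) (k : ℕ) : HasSum (fun n => f n k) (g k) :=
  (lp.evalCLM ℂ (fun _ : ℕ => ℂ) p k).hasSum hf

theorem hasSum_mulOp_apply (k : ℕ) :
    HasSum (fun n => if n ≤ k then u n * h (k - n) else 0) (mulOp p u h k) := by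
  convert hasSum_lp_apply p (hasSum_mulOp p u h) k using 2 with n
  rw [lp.coeFn_smul, Pi.smul_apply, shift_pow_apply, smul_ite, smul_zero, smul_eq_mul]

theorem hasSum_coMulOp_apply (k : ℕ) :
    HasSum (fun n => u n * h (k + n)) (coMulOp p u h k) := by
  convert hasSum_lp_apply p (hasSum_coMulOp p u h) k using 2 with n
  rw [lp.coeFn_smul, Pi.smul_apply, bshift_pow_apply, smul_eq_mul]

theorem hasSum_hankelOp_apply (k : ℕ) :
    HasSum (fun l => u (k + l) * h l) (hankelOp p u h k) := by
  have h1 := hasSum_lp_apply p (hasSum_hankelOp p u h) k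
  have h2 : Function.Injective fun l : ℕ => k + l := add_right_injective k
  rw [← h2.hasSum_iff] at h1
  · refine h1.congr_fun fun l => ?_
    simp [reflect_apply]
  · intro n hn
    have : ¬ k ≤ n := fun hk => hn ⟨n - k, by simp; omega⟩
    simp [reflect_apply, this]

theorem norm_mulOp_le : ‖mulOp p u h‖ ≤ ‖u‖ * ‖h‖ :=
  (mulOp p u).le_of_opNorm_le (norm_wsum_le _ _ u) h

theorem norm_coMulOp_le : ‖coMulOp p u h‖ ≤ ‖u‖ * ‖h‖ :=
  (coMulOp p u).le_of_opNorm_le (norm_wsum_le _ _ u) h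

end operators

theorem hardy_apply_eq_inner (h : Hardy) (n : ℕ) :
    h n = inner ℂ (lp.single 2 n (1 : ℂ) : Hardy) h := by
  rw [lp.inner_single_left]; simp

theorem oneH_apply (n : ℕ) : oneH n = oneSeq n := by
  rw [oneH, oneSeq, lp.single_apply, Pi.single_apply]

theorem inner_oneH_left (h : Hardy) : inner ℂ oneH h = h 0 := (hardy_apply_eq_inner h 0).symm

theorem inner_oneH_right (h : Hardy) : inner ℂ h oneH = conj (h 0) := by
  rw [← inner_oneH_left, inner_conj_symm]

theorem bshift_shift (h : Hardy) : bshift 2 (shift 2 h) = h := by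
  refine lp.ext (funext fun n => ?_)
  exact (bshift_apply 2 (shift 2 h) n).trans (shift_succ 2 h n)

theorem shift_bshift (h : Hardy) : shift 2 (bshift 2 h) = h - h 0 • oneH := by
  ext n
  rw [lp.coeFn_sub, Pi.sub_apply, lp.coeFn_smul, Pi.smul_apply, oneH_apply, oneSeq]
  cases n <;> simp

theorem inner_shift_left (f g : Hardy) : inner ℂ (shift 2 f) g = inner ℂ f (bshift 2 g) := by
  have h := lp.hasSum_inner (𝕜 := ℂ) (shift 2 f) g
  rw [← hasSum_nat_add_iff' 1, Finset.sum_range_one, shift_zero, inner_zero_left, sub_zero] at h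
  exact h.unique (lp.hasSum_inner (𝕜 := ℂ) f (bshift 2 g))

theorem inner_shift_right (f g : Hardy) : inner ℂ f (shift 2 g) = inner ℂ (bshift 2 f) g := by
  rw [← inner_conj_symm, inner_shift_left, inner_conj_symm]

theorem inner_shift_pow_left (n : ℕ) (f g : Hardy) :
    inner ℂ ((shift 2 ^ n) f) g = inner ℂ f ((bshift 2 ^ n) g) := by
  induction n generalizing g with
  | zero => simp
  | succ n ih =>
    rw [pow_succ', pow_succ, mul_apply_eq_comp, mul_apply_eq_comp, inner_shift_left, ih]

theorem single_eq_shift_pow (n : ℕ) : (lp.single 2 n (1 : ℂ) : Hardy) = (shift 2 ^ n) oneH := by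
  ext k
  rw [shift_pow_apply, oneH_apply, lp.single_apply, Pi.single_apply, oneSeq]
  grind

theorem hardy_ext_inner {f g : Hardy} (h : ∀ v : Hardy, inner ℂ v f = inner ℂ v g) : f = g :=
  ext_inner_left ℂ h

/-! ### Multiplication and Toeplitz operators -/

theorem mulOp_shift (u : Wiener) (h : Hardy) :
    mulOp 2 u (shift 2 h) = shift 2 (mulOp 2 u h) := by
  refine (hasSum_mulOp 2 u (shift 2 h)).unique ?_
  convert (shift 2).hasSum (hasSum_mulOp 2 u h) using 2 with n
  rw [map_smul, ← mul_apply_eq_comp, ← mul_apply_eq_comp, (Commute.refl (shift 2)).pow_left n]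

theorem coMulOp_bshift (u : Wiener) (h : Hardy) :
    coMulOp 2 u (bshift 2 h) = bshift 2 (coMulOp 2 u h) := by
  refine (hasSum_coMulOp 2 u (bshift 2 h)).unique ?_
  convert (bshift 2).hasSum (hasSum_coMulOp 2 u h) using 2 with n
  rw [map_smul, ← mul_apply_eq_comp, ← mul_apply_eq_comp, (Commute.refl (bshift 2)).pow_left n]

theorem inner_mulOp_left (u : Wiener) (f g : Hardy) :
    inner ℂ (mulOp 2 u f) g = inner ℂ f (coMulOp 2 (star u) g) := by
  have h1 := (innerSLFlip ℂ g).hasSum (hasSum_mulOp 2 u f)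
  have h2 := (innerSL ℂ f).hasSum (hasSum_coMulOp 2 (star u) g)
  refine h1.unique ?_
  convert h2 using 2 with n
  simp only [innerSLFlip_apply_apply, innerSL_apply_apply, inner_smul_left, inner_smul_right,
    inner_shift_pow_left, lp.star_apply]
  · rfl
  · rfl

theorem inner_mulOp_right (u : Wiener) (f g : Hardy) :
    inner ℂ f (mulOp 2 u g) = inner ℂ (coMulOp 2 (star u) f) g := by
  rw [← inner_conj_symm, inner_mulOp_left, inner_conj_symm]

/-- The inclusion of the Wiener algebra into the Hardy space. -/
def emb : Wiener →L[ℂ] Hardy := (ContinuousLinearMap.apply ℂ Hardy oneH).comp (mulOp 2)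

theorem emb_eq (u : Wiener) : emb u = mulOp 2 u oneH := rfl

theorem emb_apply (u : Wiener) (n : ℕ) : emb u n = u n := by
  refine (hasSum_mulOp_apply 2 u oneH n).unique ?_
  convert hasSum_ite_eq n (u n) using 2 with k
  rw [oneH_apply, oneSeq]
  split_ifs <;> first | omega | simp_all

theorem star_hankelOp (u : Wiener) (h : Hardy) :
    star (hankelOp 2 u h) = hankelOp 2 (star u) (star h) := by
  ext k
  rw [lp.star_apply]
  refine (hasSum_hankelOp_apply 2 u h k).star.unique ?_
  refine (hasSum_hankelOp_apply 2 (star u) (star h) k).congr_fun fun l => ?_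
  rw [star_mul', lp.star_apply, lp.star_apply]

/-! ### The shifted Hankel operator -/

/-- The shifted Hankel operator `K_u` on the Hardy space. -/
def kop (u : Wiener) (h : Hardy) : Hardy := hankelOp 2 (bshift 1 u) (star h)

theorem hasSum_kop_apply (u : Wiener) (h : Hardy) (k : ℕ) :
    HasSum (fun l => u (k + 1 + l) * conj (h l)) (kop u h k) := by
  refine (hasSum_hankelOp_apply 2 (bshift 1 u) (star h) k).congr_fun fun l => ?_
  rw [bshift_apply, Nat.add_right_comm]
  rfl

theorem kop_coe (u : Wiener) (h : Hardy) : (kop u h : ℕ → ℂ) = khankel u h :=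
  funext fun k => (hasSum_kop_apply u h k).tsum_eq.symm

theorem kop_add (u : Wiener) (f g : Hardy) : kop u (f + g) = kop u f + kop u g := by
  simp [kop]

theorem kop_sub (u : Wiener) (f g : Hardy) : kop u (f - g) = kop u f - kop u g := by
  simp [kop]

theorem kop_smul (u : Wiener) (c : ℂ) (f : Hardy) : kop u (c • f) = conj c • kop u f := by
  rw [kop, star_smul, map_smul]; rfl

theorem kop_zero (u : Wiener) : kop u 0 = 0 := by simp [kop]

theorem kop_shift (u : Wiener) (h : Hardy) : kop u (shift 2 h) = bshift 2 (kop u h) := by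
  ext k
  refine (hasSum_kop_apply u (shift 2 h) k).unique ?_
  rw [← hasSum_nat_add_iff' 1, Finset.sum_range_one, shift_zero, map_zero, mul_zero, sub_zero,
    bshift_apply]
  refine (hasSum_kop_apply u h (k + 1)).congr_fun fun l => ?_
  rw [shift_succ, ← add_assoc, Nat.add_right_comm]

theorem kop_shift_pow (u : Wiener) (n : ℕ) (h : Hardy) :
    kop u ((shift 2 ^ n) h) = (bshift 2 ^ n) (kop u h) := by
  induction n with
  | zero => simp
  | succ n ih => rw [pow_succ', pow_succ', mul_apply_eq_comp, mul_apply_eq_comp, kop_shift, ih]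

theorem inner_reflect_left (m : ℕ) (f g : Hardy) :
    inner ℂ (reflect 2 m (star f)) g = ∑ k ∈ Finset.range (m + 1), f (m - k) * g k := by
  rw [lp.inner_eq_tsum, tsum_eq_sum (s := Finset.range (m + 1))]
  · refine Finset.sum_congr rfl fun k hk => ?_
    have : k ≤ m := by simpa [Nat.lt_succ_iff] using hk
    rw [reflect_apply, if_pos this]
    simp [mul_comm]
  · intro k hk
    have : ¬ k ≤ m := by simpa [Nat.lt_succ_iff] using hk
    rw [reflect_apply, if_neg this]; simp

theorem hasSum_inner_kop (u : Wiener) (f g : Hardy) :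
    HasSum (fun m => conj (u (m + 1)) * ∑ k ∈ Finset.range (m + 1), f (m - k) * g k)
      (inner ℂ (kop u f) g) := by
  have h1 := (innerSLFlip ℂ g).hasSum (hasSum_hankelOp 2 (bshift 1 u) (star f))
  refine h1.congr_fun fun m => ?_
  rw [innerSLFlip_apply_apply, inner_smul_left, inner_reflect_left]; rfl

theorem inner_kop_comm (u : Wiener) (f g : Hardy) :
    inner ℂ (kop u f) g = inner ℂ (kop u g) f := by
  refine (hasSum_inner_kop u f g).unique ?_
  convert hasSum_inner_kop u g f using 2 with m
  congr 1
  rw [← Finset.sum_range_reflect]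
  refine Finset.sum_congr rfl fun k hk => ?_
  have : k ≤ m := by simpa [Nat.lt_succ_iff] using hk
  rw [show m + 1 - 1 - k = m - k by omega, show m - (m - k) = k by omega, mul_comm]

theorem kop_oneH (u : Wiener) : kop u oneH = bshift 2 (emb u) := by
  ext k
  refine (hasSum_kop_apply u oneH k).unique ?_
  convert hasSum_ite_eq 0 (u (k + 1)) using 2 with l
  · rw [oneH_apply, oneSeq]
    split_ifs <;> simp_all
  · rw [bshift_apply, emb_apply]

/-- `K_u` as a continuous antilinear map. -/
theorem continuous_kop (u : Wiener) : Continuous (kop u) :=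
  (hankelOp 2 (bshift 1 u)).continuous.comp continuous_star

theorem kop_mulOp (u v : Wiener) (h : Hardy) :
    kop u (mulOp 2 v h) = coMulOp 2 (star v) (kop u h) := by
  refine HasSum.unique ?_ (hasSum_coMulOp 2 (star v) (kop u h))
  have h1 := (hasSum_mulOp 2 v h).map (AddMonoidHom.mk' (kop u) (kop_add u)) (continuous_kop u)
  refine h1.congr_fun fun n => ?_
  simp only [Function.comp, AddMonoidHom.mk'_apply, kop_smul, kop_shift_pow, lp.star_apply]
  rfl

/-- `K_u²` as a linear operator. -/
def ksq (u : Wiener) : Hardy →L[ℂ] Hardy :=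
  (hankelOp 2 (bshift 1 u)).comp (hankelOp 2 (star (bshift 1 u)))

theorem ksq_apply (u : Wiener) (h : Hardy) : ksq u h = kop u (kop u h) := by
  rw [kop, kop, star_hankelOp, star_star]; rfl

theorem inner_ksq (u : Wiener) (f g : Hardy) :
    inner ℂ (ksq u f) g = inner ℂ f (ksq u g) := by
  rw [ksq_apply, ksq_apply, inner_kop_comm, ← inner_conj_symm, inner_kop_comm, inner_conj_symm]

/-- The Toeplitz operator of symbol `|u|²`. -/
def toep (u : Wiener) : Hardy →L[ℂ] Hardy := (coMulOp 2 (star u)).comp (mulOp 2 u)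

theorem toep_apply (u : Wiener) (h : Hardy) :
    toep u h = coMulOp 2 (star u) (mulOp 2 u h) := rfl

theorem inner_toep (u : Wiener) (f g : Hardy) :
    inner ℂ (toep u f) g = inner ℂ f (toep u g) := by
  rw [toep_apply, toep_apply, ← inner_mulOp_right, inner_mulOp_left]

theorem kop_bshift (u : Wiener) (h : Hardy) :
    kop u (bshift 2 h) = shift 2 (kop u h) + inner ℂ h (emb u) • oneH - conj (h 0) • emb u := by
  have h1 : bshift 2 (kop u (bshift 2 h))
      = bshift 2 (shift 2 (kop u h) + inner ℂ h (emb u) • oneH - conj (h 0) • emb u) := by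
    rw [← kop_shift, shift_bshift, kop_sub, kop_smul, kop_oneH, map_sub, map_add, bshift_shift,
      map_smul, map_smul]
    have : bshift 2 oneH = 0 := by
      ext n; rw [bshift_apply, oneH_apply]; rfl
    rw [this, smul_zero, add_zero]
  have h2 : kop u (bshift 2 h) 0
      = (shift 2 (kop u h) + inner ℂ h (emb u) • oneH - conj (h 0) • emb u) 0 := by
    rw [← inner_oneH_left, ← inner_conj_symm, inner_kop_comm, kop_oneH, inner_conj_symm,
      ← inner_shift_left, shift_bshift, inner_sub_left, inner_smul_left, inner_oneH_left,
      ← inner_oneH_left (_ - _), inner_sub_right, inner_add_right, inner_smul_right,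
      inner_smul_right, inner_oneH_left, inner_oneH_left, inner_oneH_left, oneH_apply]
    simp [oneSeq]
  ext n
  cases n with
  | zero => exact h2
  | succ n => exact congrArg (fun f : Hardy => f n) h1

theorem ksq_bshift (u : Wiener) (h : Hardy) :
    ksq u (bshift 2 h) = bshift 2 (ksq u h) + inner ℂ (emb u) h • bshift 2 (emb u)
      - h 0 • kop u (emb u) := by
  rw [ksq_apply, kop_bshift, kop_sub, kop_add, kop_smul, kop_smul, kop_shift, kop_oneH,
    ksq_apply, inner_conj_symm, conj_conj]

theorem bshift_coMulOp_emb (u : Wiener) :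
    bshift 2 (coMulOp 2 (star u) (emb u)) = kop u (emb u) := by
  rw [← coMulOp_bshift, ← kop_oneH, ← kop_mulOp, ← emb_eq]

theorem toep_oneH (u : Wiener) :
    toep u oneH = shift 2 (kop u (emb u)) + inner ℂ (emb u) (emb u) • oneH := by
  have h1 : toep u oneH = coMulOp 2 (star u) (emb u) := rfl
  have h2 := shift_bshift (coMulOp 2 (star u) (emb u))
  rw [bshift_coMulOp_emb] at h2
  have h3 : coMulOp 2 (star u) (emb u) 0 = inner ℂ (emb u) (emb u) := by
    rw [← inner_oneH_left, ← inner_mulOp_left, ← emb_eq]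
  rw [h1, h2, h3, sub_add_cancel]

theorem toep_oneH' (u : Wiener) :
    toep u oneH = ksq u oneH + conj (u 0) • emb u := by
  rw [ksq_apply, kop_oneH, kop_bshift, toep_oneH, emb_apply, sub_add_cancel]

theorem bshift_mulOp (u : Wiener) (h : Hardy) :
    bshift 2 (mulOp 2 u h) = mulOp 2 u (bshift 2 h) + h 0 • bshift 2 (emb u) := by
  have h1 : h = shift 2 (bshift 2 h) + h 0 • oneH := by rw [shift_bshift, sub_add_cancel]
  conv_lhs => rw [h1]
  rw [map_add, map_add, mulOp_shift, bshift_shift, map_smul, map_smul, emb_eq]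

theorem bshift_toep (u : Wiener) (h : Hardy) :
    bshift 2 (toep u h) = toep u (bshift 2 h) + h 0 • kop u (emb u) := by
  rw [toep_apply, ← coMulOp_bshift, bshift_mulOp, map_add, map_smul, toep_apply,
    coMulOp_bshift _ (emb u), bshift_coMulOp_emb]

theorem toep_shift (u : Wiener) (h : Hardy) :
    toep u (shift 2 h) = shift 2 (toep u h) + inner ℂ (kop u (emb u)) h • oneH := by
  refine hardy_ext_inner fun v => ?_
  rw [← inner_toep, inner_shift_right, bshift_toep, inner_add_left, inner_smul_left, inner_toep,
    inner_add_right, inner_shift_right, inner_smul_right, inner_oneH_right, mul_comm]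

/-- The cubic nonlinearity on the Wiener algebra. -/
def cubicW (u : Wiener) : Wiener := coMulOp 1 (star u) (mulOp 1 u u)

theorem emb_mulOp (u v : Wiener) : emb (mulOp 1 u v) = mulOp 2 u (emb v) := by
  ext n
  rw [emb_apply]
  refine (hasSum_mulOp_apply 1 u v n).unique ?_
  simpa only [emb_apply] using hasSum_mulOp_apply 2 u (emb v) n

theorem emb_coMulOp (u v : Wiener) : emb (coMulOp 1 u v) = coMulOp 2 u (emb v) := by
  ext n
  rw [emb_apply]
  refine (hasSum_coMulOp_apply 1 u v n).unique ?_
  simpa only [emb_apply] using hasSum_coMulOp_apply 2 u (emb v) n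

theorem emb_cubicW (u : Wiener) : emb (cubicW u) = toep u (emb u) := by
  rw [cubicW, emb_coMulOp, emb_mulOp, toep_apply]

theorem norm_cubicW_le (u : Wiener) : ‖cubicW u‖ ≤ ‖u‖ ^ 3 := by
  refine (norm_coMulOp_le 1 _ _).trans ?_
  rw [norm_star, pow_succ', sq]
  exact mul_le_mul_of_nonneg_left (norm_mulOp_le 1 _ _) (norm_nonneg _)

theorem eq_zero_of_symm_of_shift {D : Hardy → Hardy}
    (hsymm : ∀ f g, inner ℂ (D f) g = inner ℂ (D g) f)
    (hshift : ∀ f, D (shift 2 f) = bshift 2 (D f)) (hone : D oneH = 0) (f : Hardy) : D f = 0 := by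
  have hpow : ∀ n, D ((shift 2 ^ n) oneH) = 0 := by
    intro n
    induction n with
    | zero => simpa using hone
    | succ n ih => rw [pow_succ', mul_apply_eq_comp, hshift, ih, map_zero]
  ext n
  rw [hardy_apply_eq_inner, ← inner_conj_symm, hsymm, single_eq_shift_pow, hpow]
  simp

/-- The Lax pair identity for `K_u`. -/
theorem kop_cubicW (u : Wiener) (h : Hardy) :
    kop (cubicW u) h = toep u (kop u h) + kop u (toep u h) - kop u (ksq u h) := by
  rw [← sub_eq_zero]
  refine eq_zero_of_symm_of_shift (D := fun h => kop (cubicW u) h -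
    (toep u (kop u h) + kop u (toep u h) - kop u (ksq u h))) ?_ ?_ ?_ h
  · intro f g
    simp only [inner_sub_left, inner_add_left]
    rw [inner_kop_comm (cubicW u) f g, inner_toep, inner_kop_comm u f, inner_kop_comm u (toep u f),
      ← inner_toep, inner_kop_comm u (ksq u f), ← inner_ksq u _ f]
    rw [inner_toep u (kop u g), ksq_apply, ksq_apply, ]
    ring
  · intro f
    simp only [map_sub, map_add, kop_shift, bshift_toep, toep_shift, kop_add, kop_smul, kop_oneH]
    have h1 : kop u (ksq u (shift 2 f)) = ksq u (bshift 2 (kop u f)) := by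
      rw [ksq_apply, ksq_apply, kop_shift]
    have h2 : ksq u (kop u f) = kop u (ksq u f) := by rw [ksq_apply, ksq_apply]
    have h3 : kop u f 0 = conj (inner ℂ (bshift 2 (emb u)) f) := by
      rw [← inner_oneH_left, ← inner_conj_symm, inner_kop_comm, kop_oneH]
    rw [h1, ksq_bshift, h2, inner_conj_symm, ← inner_conj_symm f, inner_kop_comm u (emb u) f,
      inner_conj_symm]
    module
  · rw [kop_oneH, emb_cubicW, bshift_toep, kop_oneH, toep_oneH, kop_add, kop_smul, kop_shift,
      kop_oneH, ← ksq_apply, ksq_apply u oneH, kop_oneH, ← ksq_apply, ksq_bshift, emb_apply]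
    rw [inner_conj_symm]
    module

theorem hasSum_cubicW_aux (u : Wiener) (n k : ℕ) :
    HasSum (fun q : ℕ × ℕ => if q.1 + q.2 = k + n then u q.1 * conj (u k) * u q.2 else 0)
      (conj (u k) * mulOp 1 u u (n + k)) := by
  have hs : Summable fun q : ℕ × ℕ =>
      if q.1 + q.2 = k + n then u q.1 * conj (u k) * u q.2 else 0 := by
    refine Summable.of_norm_bounded
      ((u.summable_norm.mul_right ‖u k‖).mul_of_nonneg u.summable_norm
        (fun _ => by positivity) fun _ => norm_nonneg _) fun q => ?_
    split_ifs
    · simp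
    · rw [norm_zero]; positivity
  have h1 := hs.hasSum.prod_fiberwise
    (g := fun j => conj (u k) * if j ≤ n + k then u j * u (n + k - j) else 0) fun j => by
      by_cases hj : j ≤ n + k
      · convert hasSum_single (n + k - j) _ using 1
        · rw [if_pos hj, if_pos (by omega)]; ring
        · intro l hl
          exact if_neg (by omega)
      · rw [if_neg hj, mul_zero]
        refine hasSum_zero.congr_fun fun l => if_neg (by simp only; omega)
  rw [((hasSum_mulOp_apply 1 u u (n + k)).mul_left (conj (u k))).unique h1]
  exact hs.hasSum

/-- The coefficients of the cubic nonlinearity. -/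
theorem cubicW_apply (u : Wiener) (n : ℕ) : cubicW u n = cubic u n := by
  have hs : Summable fun q : ℕ × ℕ × ℕ =>
      if q.2.1 + q.2.2 = q.1 + n then u q.2.1 * conj (u q.1) * u q.2.2 else 0 := by
    refine Summable.of_norm_bounded
      (u.summable_norm.mul_of_nonneg (u.summable_norm.mul_of_nonneg u.summable_norm
        (fun _ => norm_nonneg _) fun _ => norm_nonneg _)
        (fun _ => norm_nonneg _) fun _ => by positivity) fun q => ?_
    split_ifs
    · simp only [norm_mul, RCLike.norm_conj]
      exact le_of_eq (by ring)
    · rw [norm_zero]; positivity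
  have h1 := hs.hasSum.prod_fiberwise fun k => hasSum_cubicW_aux u n k
  have h2 := hasSum_coMulOp_apply 1 (star u) (mulOp 1 u u) n
  rw [cubicW, h2.unique (h1.congr_fun fun k => by rw [lp.star_apply]; rfl), cubic]
  let e : ℕ × ℕ × ℕ ≃ ℕ × ℕ × ℕ :=
    ⟨fun q => (q.2.1, q.1, q.2.2), fun q => (q.2.1, q.1, q.2.2), fun _ => rfl, fun _ => rfl⟩
  exact e.tsum_eq fun q =>
    if q.1 + q.2.2 = q.2.1 + n then u q.1 * conj (u q.2.1) * u q.2.2 else 0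

/-- The weighted norm `∑ (n + 1) |uₙ|` controlled by `H²`. -/
theorem summable_weighted_of_memHs {u : ℕ → ℂ} (hu : MemHs 2 u) :
    Summable fun n : ℕ => ((n : ℝ) + 1) * ‖u n‖ := by
  have h1 : Summable fun n : ℕ => ((n : ℝ) ^ 2)⁻¹ := Real.summable_nat_pow_inv.2 one_lt_two
  have h2 : Summable fun n : ℕ => (((n + 1 : ℕ) : ℝ) ^ 2)⁻¹ := (summable_nat_add_iff 1).2 h1
  refine Summable.of_nonneg_of_le (fun n => by positivity) (fun n => ?_)
    ((Summable.add hu h2).mul_left 4)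
  have hr : ((1 : ℝ) + (n : ℝ) ^ 2) ^ (2 : ℝ) = (1 + (n : ℝ) ^ 2) ^ 2 :=
    Real.rpow_two _
  rw [hr]
  push_cast
  set x : ℝ := n + 1 with hx
  have hx0 : 0 < x := by positivity
  have hx2 : x ^ 2 ≤ 2 * (1 + (n : ℝ) ^ 2) := by
    rw [hx]; nlinarith [sq_nonneg ((n : ℝ) - 1)]
  have hx4 : x ^ 4 ≤ 4 * (1 + (n : ℝ) ^ 2) ^ 2 := by nlinarith [sq_nonneg x]
  have hy := norm_nonneg (u n)
  have key : x * ‖u n‖ ≤ x ^ 4 * ‖u n‖ ^ 2 + (x ^ 2)⁻¹ := by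
    have h3 : (x ^ 2 * ‖u n‖) * x⁻¹ = x * ‖u n‖ := by field_simp
    have h4 := two_mul_le_add_sq (x ^ 2 * ‖u n‖) x⁻¹
    rw [mul_assoc, h3] at h4
    have h5 : (x ^ 2 * ‖u n‖) ^ 2 = x ^ 4 * ‖u n‖ ^ 2 := by ring
    rw [h5, inv_pow] at h4
    nlinarith [mul_nonneg hx0.le hy]
  have h6 : 0 ≤ (x ^ 2)⁻¹ := by positivity
  nlinarith [mul_le_mul_of_nonneg_right hx4 (sq_nonneg ‖u n‖)]

theorem memℓp_one_of_summable {u : ℕ → ℂ} (hu : Summable fun n : ℕ => ((n : ℝ) + 1) * ‖u n‖) :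
    Memℓp u 1 := by
  refine memℓp_gen ?_
  simp only [ENNReal.toReal_one, Real.rpow_one]
  refine Summable.of_nonneg_of_le (fun n => norm_nonneg _) (fun n => ?_) hu
  exact le_mul_of_one_le_left (norm_nonneg _) (by simp)

/-- The constant function `1` in the Wiener algebra. -/
def oneW : Wiener := lp.single 1 0 1

theorem oneW_apply (n : ℕ) : oneW n = oneSeq n := by
  rw [oneW, oneSeq, lp.single_apply, Pi.single_apply]

theorem emb_oneW : emb oneW = oneH := by
  ext n
  rw [emb_apply, oneW_apply, oneH_apply]

theorem norm_oneW : ‖oneW‖ = 1 := by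
  rw [oneW, lp.norm_single (by simp)]; simp

theorem norm_apply_le (u : Wiener) (n : ℕ) : ‖u n‖ ≤ ‖u‖ :=
  lp.norm_apply_le_norm one_ne_zero u n

/-- The vector field of the `α`-Szegő equation. -/
def field (α : ℝ) (u : Wiener) : Wiener :=
  -Complex.I • (cubicW u + ((α : ℂ) * u 0) • oneW)

theorem field_apply (α : ℝ) (u : Wiener) (n : ℕ) :
    field α u n = -Complex.I * (cubic u n + (α : ℂ) * u 0 * oneSeq n) := by
  rw [field, lp.coeFn_smul, Pi.smul_apply, lp.coeFn_add, Pi.add_apply, lp.coeFn_smul,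
    Pi.smul_apply, oneW_apply, cubicW_apply, smul_eq_mul, smul_eq_mul]

theorem norm_field_le (α : ℝ) (u : Wiener) : ‖field α u‖ ≤ ‖u‖ ^ 3 + |α| * ‖u‖ := by
  rw [field, norm_smul, norm_neg, Complex.norm_I, one_mul]
  refine (norm_add_le _ _).trans (add_le_add (norm_cubicW_le u) ?_)
  rw [norm_smul, norm_oneW, mul_one, norm_mul, Complex.norm_real, Real.norm_eq_abs]
  exact mul_le_mul_of_nonneg_left (norm_apply_le u 0) (abs_nonneg _)

theorem continuous_cubicW : Continuous cubicW := by
  have h1 : Continuous fun u : Wiener => mulOp 1 u u :=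
    (mulOp 1).continuous.clm_apply continuous_id
  exact ((coMulOp 1).continuous.comp continuous_star).clm_apply h1

theorem continuous_field (α : ℝ) : Continuous (field α) := by
  have h0 : Continuous fun u : Wiener => u 0 := (lp.evalCLM ℂ (fun _ : ℕ => ℂ) 1 0).continuous
  exact (continuous_cubicW.add ((h0.const_mul (α : ℂ)).smul continuous_const)).const_smul
    (-Complex.I)

theorem kop_oneW (h : Hardy) : kop oneW h = 0 := by
  have : bshift 1 oneW = 0 := by
    ext n; rw [bshift_apply, oneW_apply]; rfl
  rw [kop, this, map_zero]; rfl

theorem kop_symbol_add (u v : Wiener) (h : Hardy) : kop (u + v) h = kop u h + kop v h := by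
  rw [kop, map_add, map_add]; rfl

theorem kop_symbol_smul (c : ℂ) (u : Wiener) (h : Hardy) : kop (c • u) h = c • kop u h := by
  rw [kop, map_smul, map_smul]; rfl

/-- The Lax operator of the `α`-Szegő equation. -/
def lax (u : Wiener) : Hardy →L[ℂ] Hardy := (-Complex.I) • toep u + (Complex.I / 2) • ksq u

theorem lax_apply (u : Wiener) (h : Hardy) :
    lax u h = (-Complex.I) • toep u h + (Complex.I / 2) • ksq u h := rfl

theorem inner_lax (u : Wiener) (f g : Hardy) :
    inner ℂ (lax u f) g = - inner ℂ f (lax u g) := by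
  simp only [lax_apply, inner_add_left, inner_add_right, inner_smul_left, inner_smul_right,
    inner_toep, inner_ksq, map_neg, map_div₀, Complex.conj_I, map_ofNat]
  ring

theorem continuous_lax : Continuous lax := by
  have h1 : Continuous fun u : Wiener => coMulOp 2 (star u) :=
    (coMulOp 2).continuous.comp continuous_star
  have h2 : Continuous fun u : Wiener => hankelOp 2 (bshift 1 u) :=
    (hankelOp 2).continuous.comp (bshift 1).continuous
  have h3 : Continuous fun u : Wiener => hankelOp 2 (star (bshift 1 u)) :=
    (hankelOp 2).continuous.comp (continuous_star.comp (bshift 1).continuous)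
  exact ((h1.clm_comp (mulOp 2).continuous).const_smul (-Complex.I)).add
    ((h2.clm_comp h3).const_smul (Complex.I / 2))

/-- The Lax equation for `K_u`: the time derivative of `K_u` is a commutator. -/
theorem kop_field (α : ℝ) (u : Wiener) (h : Hardy) :
    kop (field α u) h = lax u (kop u h) - kop u (lax u h) := by
  rw [field, kop_symbol_smul, kop_symbol_add, kop_symbol_smul, kop_oneW, smul_zero, add_zero,
    kop_cubicW, lax_apply, lax_apply, kop_add, kop_smul, kop_smul, ksq_apply u (kop u h),
    ← ksq_apply u h]
  simp only [map_neg, map_div₀, Complex.conj_I, map_ofNat]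
  module

theorem emb_field (α : ℝ) (u : Wiener) :
    emb (field α u) = lax u (emb u) - (Complex.I / 2) • ksq u (emb u)
      - (Complex.I * α * u 0) • oneH := by
  rw [field, map_smul, map_add, map_smul, emb_cubicW, emb_oneW, lax_apply]
  module

theorem lax_oneH (u : Wiener) :
    lax u oneH = -(Complex.I / 2) • ksq u oneH - (Complex.I * conj (u 0)) • emb u := by
  rw [lax_apply, toep_oneH']
  module

theorem bshift_lax (u : Wiener) (h : Hardy) :
    bshift 2 (lax u h) = lax u (bshift 2 h) - (Complex.I / 2 * h 0) • kop u (emb u)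
      - (Complex.I / 2 * inner ℂ (emb u) h) • bshift 2 (emb u) := by
  rw [lax_apply, map_add, map_smul, map_smul, bshift_toep, lax_apply, ksq_bshift]
  module

end Szego

namespace Szego

open Set

/-! ### Differential calculus on an interval -/

/-- A coefficientwise derivative with bounded `ℓ¹` norm controls the `ℓ¹` increments. -/
theorem norm_sub_le_of_coeff_deriv {f f' : ℝ → Wiener} {s : Set ℝ} {C : ℝ} (hs : Convex ℝ s)
    (hf : ∀ n, ∀ τ ∈ s, HasDerivWithinAt (fun t => f t n) (f' τ n) s τ)
    (hC : ∀ τ ∈ s, ‖f' τ‖ ≤ C) {x y : ℝ} (hx : x ∈ s) (hy : y ∈ s) :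
    ‖f y - f x‖ ≤ C * ‖y - x‖ := by
  have hC0 : 0 ≤ C := (norm_nonneg _).trans (hC x hx)
  have key : ∀ (a : ℕ → ℂ) (S : Finset ℕ),
      ‖∑ i ∈ S, (lp.single 1 i (a i) : Wiener)‖ = ∑ i ∈ S, ‖a i‖ := fun a S => by
    simpa using lp.norm_sum_single (p := 1) (by simp) a S
  refine lp.norm_le_of_forall_sum_le (by simp) (by positivity) fun S => ?_
  simp only [ENNReal.toReal_one, Real.rpow_one]
  let P : ℕ → ℂ →L[ℝ] Wiener := lp.singleContinuousLinearMap ℝ (fun _ : ℕ => ℂ) 1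
  have hd : ∀ τ ∈ s, HasDerivWithinAt (fun t => ∑ i ∈ S, P i (f t i)) (∑ i ∈ S, P i (f' τ i)) s τ :=
    fun τ hτ => HasDerivWithinAt.fun_sum fun i _ =>
      (P i).hasFDerivAt.comp_hasDerivWithinAt τ (hf i τ hτ)
  have h1 := hs.norm_image_sub_le_of_norm_hasDerivWithin_le hd (C := C) (fun τ hτ => by
    refine (key (f' τ) S).trans_le ((le_trans ?_) (hC τ hτ))
    rw [Wiener.norm_eq]
    exact (f' τ).summable_norm.sum_le_tsum S fun _ _ => norm_nonneg _) hx hy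
  rw [← Finset.sum_sub_distrib] at h1
  simp only [← map_sub] at h1
  exact (key (fun i => f y i - f x i) S).symm.trans_le h1

/-- A coefficientwise derivative that is continuous in `ℓ¹` is a derivative in `ℓ¹`. -/
theorem hasDerivWithinAt_of_coeff {f f' : ℝ → Wiener} {s : Set ℝ} (hs : Convex ℝ s)
    (hf : ∀ n, ∀ τ ∈ s, HasDerivWithinAt (fun t => f t n) (f' τ n) s τ)
    (hc : ContinuousOn f' s) {t : ℝ} (ht : t ∈ s) : HasDerivWithinAt f (f' t) s t := by
  rw [hasDerivWithinAt_iff_isLittleO, Asymptotics.isLittleO_iff]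
  intro ε hε
  obtain ⟨δ, hδ, hδ'⟩ := Metric.continuousOn_iff.1 hc t ht ε hε
  filter_upwards [inter_mem_nhdsWithin s (Metric.ball_mem_nhds t hδ)] with y hy
  have h1 := norm_sub_le_of_coeff_deriv (f := fun τ => f τ - (τ - t) • f' t)
    (f' := fun τ => f' τ - f' t) (C := ε) (hs.inter (convex_ball t δ)) (fun n τ hτ => by
      have h2 := ((hf n τ hτ.1).mono inter_subset_left).sub
        (((hasDerivWithinAt_id τ (s ∩ Metric.ball t δ)).sub_const t).smul_const (f' t n))
      rw [one_smul] at h2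
      exact h2) (fun τ hτ => by
      rw [← dist_eq_norm]
      exact (hδ' τ hτ.1 hτ.2).le) ⟨ht, Metric.mem_ball_self hδ⟩ hy
  simp only [sub_self, zero_smul, sub_zero] at h1
  rwa [sub_right_comm]

theorem eq_of_hasDerivWithinAt_zero {E : Type*} [NormedAddCommGroup E] [NormedSpace ℝ E]
    {f : ℝ → E} {s : Set ℝ} (hs : Convex ℝ s) (hf : ∀ τ ∈ s, HasDerivWithinAt f 0 s τ) {x y : ℝ}
    (hx : x ∈ s) (hy : y ∈ s) : f y = f x := by
  have := hs.norm_image_sub_le_of_norm_hasDerivWithin_le hf (C := 0) (fun _ _ => by simp) hx hy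
  rwa [zero_mul, norm_le_zero_iff, sub_eq_zero] at this

/-- Grönwall uniqueness in either time direction. -/
theorem eq_zero_of_norm_deriv_le {E : Type*} [NormedAddCommGroup E] [NormedSpace ℝ E]
    {f f' : ℝ → E} {s : Set ℝ} (hs : Convex ℝ s) {K : ℝ}
    (hf : ∀ τ ∈ s, HasDerivWithinAt f (f' τ) s τ) (hK : ∀ τ ∈ s, ‖f' τ‖ ≤ K * ‖f τ‖) {x y : ℝ}
    (hx : x ∈ s) (hy : y ∈ s) (h0 : f x = 0) : f y = 0 := by
  have hmap : MapsTo (fun θ : ℝ => x + θ * (y - x)) (Icc 0 1) s := fun θ hθ => by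
    have := hs hx hy (sub_nonneg.2 hθ.2) hθ.1 (by ring)
    convert this using 1
    simp only [smul_eq_mul]; ring
  have hd : ∀ θ ∈ Icc (0 : ℝ) 1, HasDerivWithinAt (fun θ => f (x + θ * (y - x)))
      ((y - x) • f' (x + θ * (y - x))) (Icc 0 1) θ := fun θ hθ => by
    have h1 : HasDerivWithinAt (fun θ : ℝ => x + θ * (y - x)) (y - x) (Icc 0 1) θ := by
      simpa using ((hasDerivWithinAt_id θ (Icc (0 : ℝ) 1)).mul_const (y - x)).const_add x
    exact (hf _ (hmap hθ)).scomp θ h1 hmap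
  have := eq_zero_of_abs_deriv_le_mul_abs_self_of_eq_zero_right (K := |y - x| * K)
    (fun θ hθ => (hd θ hθ).continuousWithinAt)
    (fun θ hθ => (hd θ (Ico_subset_Icc_self hθ)).mono_of_mem_nhdsWithin
      (Icc_mem_nhdsGE_of_mem hθ)) (by simpa using h0) (fun θ hθ => by
      rw [norm_smul, Real.norm_eq_abs, mul_assoc]
      exact mul_le_mul_of_nonneg_left (hK _ (hmap (Ico_subset_Icc_self hθ))) (abs_nonneg _)) 1
    (right_mem_Icc.2 zero_le_one)
  simpa using this

/-- Solutions of skew-adjoint linear equations preserve inner products. -/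
theorem inner_eq_of_skew {f g : ℝ → Hardy} {C : ℝ → Hardy →L[ℂ] Hardy} {s : Set ℝ}
    (hs : Convex ℝ s) (hC : ∀ τ h k, inner ℂ (C τ h) k = - inner ℂ h (C τ k))
    (hf : ∀ τ ∈ s, HasDerivWithinAt f (C τ (f τ)) s τ)
    (hg : ∀ τ ∈ s, HasDerivWithinAt g (C τ (g τ)) s τ) {x y : ℝ} (hx : x ∈ s) (hy : y ∈ s) :
    inner ℂ (f y) (g y) = inner ℂ (f x) (g x) := by
  refine eq_of_hasDerivWithinAt_zero (f := fun τ => inner ℂ (f τ) (g τ)) hs (fun τ hτ => ?_) hx hy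
  have h := (hf τ hτ).inner ℂ (hg τ hτ)
  rw [hC, add_neg_cancel] at h
  exact h

theorem eq_zero_of_skew {f : ℝ → Hardy} {C : ℝ → Hardy →L[ℂ] Hardy} {s : Set ℝ}
    (hs : Convex ℝ s) (hC : ∀ τ h k, inner ℂ (C τ h) k = - inner ℂ h (C τ k))
    (hf : ∀ τ ∈ s, HasDerivWithinAt f (C τ (f τ)) s τ) {x y : ℝ} (hx : x ∈ s) (hy : y ∈ s)
    (h0 : f x = 0) : f y = 0 := by
  have := inner_eq_of_skew hs hC hf hf hx hy
  rwa [h0, inner_zero_left, inner_self_eq_zero] at this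

/-- The propagator of a bounded linear equation over a short interval. -/
theorem exists_propagator {C : ℝ → Hardy →L[ℂ] Hardy} {s r K : ℝ}
    (hc : ContinuousOn C (uIcc s r)) (hK : ∀ τ ∈ uIcc s r, ‖C τ‖ ≤ K) (hsr : K * |r - s| * 2 ≤ 1) :
    ∃ W : ℝ → Hardy →L[ℂ] Hardy, W s = 1 ∧ ∀ c, ∀ τ ∈ uIcc s r,
      HasDerivWithinAt (fun τ => W τ c) (C τ (W τ c)) (uIcc s r) τ := by
  have hK0 : 0 ≤ K := (norm_nonneg _).trans (hK s left_mem_uIcc)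
  have hPL : IsPicardLindelof (fun τ (W : Hardy →L[ℂ] Hardy) => (C τ).comp W)
      (tmin := s ⊓ r) (tmax := s ⊔ r) ⟨s, inf_le_left, le_sup_left⟩ 1 1 0 (2 * K.toNNReal)
      K.toNNReal := by
    refine ⟨fun t ht => ?_, fun x _ => ?_, fun t ht x hx => ?_, ?_⟩
    · refine LipschitzWith.lipschitzOnWith (LipschitzWith.of_dist_le_mul fun V W => ?_)
      rw [dist_eq_norm, dist_eq_norm, ← ContinuousLinearMap.comp_sub, Real.coe_toNNReal K hK0]
      exact (ContinuousLinearMap.opNorm_comp_le _ _).trans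
        (mul_le_mul_of_nonneg_right (hK t ht) (norm_nonneg _))
    · exact hc.clm_comp continuousOn_const
    · have hx2 : ‖x‖ ≤ 2 := by
        have h1 : ‖x - 1‖ ≤ 1 := by simpa [dist_eq_norm] using hx
        have h2 : ‖(1 : Hardy →L[ℂ] Hardy)‖ ≤ 1 := ContinuousLinearMap.norm_id_le
        have h3 := norm_le_norm_add_norm_sub' x 1
        linarith
      rw [NNReal.coe_mul, Real.coe_toNNReal K hK0, mul_comm, NNReal.coe_ofNat]
      exact (ContinuousLinearMap.opNorm_comp_le _ _).trans
        (mul_le_mul (hK t ht) hx2 (norm_nonneg _) hK0)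
    · rw [NNReal.coe_mul, Real.coe_toNNReal K hK0, NNReal.coe_ofNat, NNReal.coe_one,
        NNReal.coe_zero, sub_zero]
      have : max (s ⊔ r - s) (s - s ⊓ r) ≤ |r - s| := by
        rcases le_total s r with h | h
        · rw [sup_eq_right.2 h, inf_eq_left.2 h, abs_of_nonneg (by linarith)]; simp [h]
        · rw [sup_eq_left.2 h, inf_eq_right.2 h, abs_of_nonpos (by linarith)]; simp [h]
      calc 2 * K * max (s ⊔ r - s) (s - s ⊓ r) ≤ 2 * K * |r - s| := by gcongr
        _ ≤ 1 := by linarith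
  obtain ⟨W, hW, hd⟩ := hPL.exists_eq_forall_mem_Icc_hasDerivWithinAt₀
  refine ⟨W, hW, fun c τ hτ => ?_⟩
  exact ((ContinuousLinearMap.apply ℂ Hardy c).restrictScalars ℝ).hasFDerivAt.comp_hasDerivWithinAt
    τ (hd τ hτ)

theorem norm_kop_le (u : Wiener) (h : Hardy) : ‖kop u h‖ ≤ ‖u‖ * ‖h‖ := by
  refine ((hankelOp 2 (bshift 1 u)).le_of_opNorm_le (norm_wsum_le _ _ _) _).trans ?_
  rw [norm_star]
  refine mul_le_mul_of_nonneg_right ?_ (norm_nonneg _)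
  simpa using (bshift 1).le_of_opNorm_le (norm_partialShift_le ..) u

theorem isBoundedBilinearMap_kop :
    IsBoundedBilinearMap ℝ fun p : Wiener × Hardy => kop p.1 p.2 where
  add_left u v h := kop_symbol_add u v h
  smul_left c u h := kop_symbol_smul (c : ℂ) u h
  add_right u f g := kop_add u f g
  smul_right c u h := by
    refine (kop_smul u (c : ℂ) h).trans ?_
    rw [Complex.conj_ofReal]; rfl
  bound := ⟨1, one_pos, fun u h => by rw [one_mul]; exact norm_kop_le u h⟩

theorem hasDerivWithinAt_kop {U : ℝ → Wiener} {g : ℝ → Hardy} {U' : Wiener} {g' : Hardy}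
    {s : Set ℝ} {τ : ℝ} (hU : HasDerivWithinAt U U' s τ) (hg : HasDerivWithinAt g g' s τ) :
    HasDerivWithinAt (fun t => kop (U t) (g t)) (kop (U τ) g' + kop U' (g τ)) s τ :=
  have h := isBoundedBilinearMap_kop.hasFDerivAt (U τ, g τ)
  h.comp_hasDerivWithinAt (f := fun t => (U t, g t)) τ (hU.prodMk hg)

theorem hasDerivWithinAt_clm {A : Hardy →L[ℂ] Hardy} {g : ℝ → Hardy} {g' : Hardy}
    {s : Set ℝ} {τ : ℝ} (hg : HasDerivWithinAt g g' s τ) :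
    HasDerivWithinAt (fun t => A (g t)) (A g') s τ :=
  (A.restrictScalars ℝ).hasFDerivAt.comp_hasDerivWithinAt τ hg

/-- `W` carries the spectral data of `K_u` to that of `K_v`, as the Lax flow of the `α`-Szegő
equation does. -/
structure Transports (α : ℝ) (u v : Wiener) (W : Hardy →L[ℂ] Hardy) : Prop where
  inner_map : ∀ f g, inner ℂ (W f) (W g) = inner ℂ f g
  kop_map : ∀ c, kop v (W c) = W (kop u c)
  conserved : ∀ (c : Hardy) (μ : ℝ), ksq u c = (μ : ℂ) • c →
    ‖inner ℂ (emb v) (W c)‖ ^ 2 - α * ‖W c 0‖ ^ 2 = ‖inner ℂ (emb u) c‖ ^ 2 - α * ‖c 0‖ ^ 2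
  orthogonal : ∀ (c : Hardy) (μ : ℝ), ksq u c = (μ : ℂ) • c → inner ℂ (emb u) c = 0 → c 0 = 0 →
    inner ℂ (emb v) (W c) = 0 ∧ W c 0 = 0 ∧ bshift 2 (W c) = W (bshift 2 c)

theorem Transports.ksq_map {α : ℝ} {u v : Wiener} {W : Hardy →L[ℂ] Hardy}
    (h : Transports α u v W) (c : Hardy) : ksq v (W c) = W (ksq u c) := by
  rw [ksq_apply, h.kop_map, h.kop_map, ksq_apply]

theorem Transports.refl (α : ℝ) (u : Wiener) : Transports α u u 1 :=
  ⟨fun _ _ => rfl, fun _ => rfl, fun _ _ _ => rfl, fun _ _ _ h1 h2 => ⟨h1, h2, rfl⟩⟩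

theorem Transports.trans {α : ℝ} {u v w : Wiener} {V W : Hardy →L[ℂ] Hardy}
    (h : Transports α u v V) (h' : Transports α v w W) : Transports α u w (W.comp V) := by
  have hk : ∀ (c : Hardy) (μ : ℝ), ksq u c = (μ : ℂ) • c → ksq v (V c) = (μ : ℂ) • V c :=
    fun c μ hc => by rw [h.ksq_map, hc, map_smul]
  refine ⟨fun f g => ?_, fun c => ?_, fun c μ hc => ?_, fun c μ hc h1 h2 => ?_⟩
  · exact (h'.inner_map _ _).trans (h.inner_map f g)
  · exact (h'.kop_map _).trans (congrArg W (h.kop_map c))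
  · exact (h'.conserved _ μ (hk c μ hc)).trans (h.conserved c μ hc)
  · obtain ⟨h3, h4, h5⟩ := h.orthogonal c μ hc h1 h2
    obtain ⟨h6, h7, h8⟩ := h'.orthogonal _ μ (hk c μ hc) h3 h4
    exact ⟨h6, h7, h8.trans (congrArg W h5)⟩

theorem Transports.of_propagator {α : ℝ} {U : ℝ → Wiener} {S : Set ℝ} (hS : Convex ℝ S)
    (hU : ∀ τ ∈ S, HasDerivWithinAt U (field α (U τ)) S τ) {B : ℝ} (hB : ∀ τ ∈ S, ‖U τ‖ ≤ B)
    {W : ℝ → Hardy →L[ℂ] Hardy} {s r : ℝ} (hs : s ∈ S) (hr : r ∈ S) (hW1 : W s = 1)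
    (hW : ∀ c, ∀ τ ∈ S, HasDerivWithinAt (fun τ => W τ c) (lax (U τ) (W τ c)) S τ) :
    Transports α (U s) (U r) (W r) := by
  have hskew : ∀ τ h k, inner ℂ (lax (U τ) h) k = - inner ℂ h (lax (U τ) k) :=
    fun τ => inner_lax (U τ)
  have hkop : ∀ c, ∀ t ∈ S, kop (U t) (W t c) = W t (kop (U s) c) := by
    intro c t ht
    refine sub_eq_zero.1 (eq_zero_of_skew
      (f := fun τ => kop (U τ) (W τ c) - W τ (kop (U s) c)) hS hskew (fun τ hτ => ?_) hs ht
      (by simp [hW1]))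
    have := (hasDerivWithinAt_kop (hU τ hτ) (hW c τ hτ)).sub (hW (kop (U s) c) τ hτ)
    refine this.congr_deriv ?_
    rw [kop_field, map_sub, add_sub_cancel]
  have hksq : ∀ (c : Hardy) (μ : ℝ), ksq (U s) c = (μ : ℂ) • c → ∀ t ∈ S,
      ksq (U t) (W t c) = (μ : ℂ) • W t c := by
    intro c μ hc t ht
    rw [ksq_apply, hkop c t ht, hkop _ t ht, ← ksq_apply, hc, map_smul]
  have hX : ∀ (c : Hardy) (μ : ℝ), ksq (U s) c = (μ : ℂ) • c → ∀ t ∈ S,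
      HasDerivWithinAt (fun τ => inner ℂ (emb (U τ)) (W τ c))
        (Complex.I / 2 * μ * inner ℂ (emb (U t)) (W t c)
          + Complex.I * α * (starRingEnd ℂ) (U t 0) * W t c 0) S t := by
    intro c μ hc t ht
    have h1 : HasDerivWithinAt (fun τ => emb (U τ)) (emb (field α (U t))) S t :=
      (emb.restrictScalars ℝ).hasFDerivAt.comp_hasDerivWithinAt t (hU t ht)
    have h2 := h1.inner ℂ (hW c t ht)
    refine h2.congr_deriv ?_
    rw [emb_field, inner_sub_left, inner_sub_left, hskew, inner_smul_left, inner_smul_left,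
      inner_ksq, hksq c μ hc t ht, inner_smul_right, inner_oneH_left]
    simp only [map_mul, map_div₀, Complex.conj_I, map_ofNat, Complex.conj_ofReal]
    ring
  have hY : ∀ (c : Hardy) (μ : ℝ), ksq (U s) c = (μ : ℂ) • c → ∀ t ∈ S,
      HasDerivWithinAt (fun τ => W τ c 0)
        (-(Complex.I / 2 * μ * W t c 0) - Complex.I * U t 0 * inner ℂ (emb (U t)) (W t c)) S t := by
    intro c μ hc t ht
    have h1 := (hasDerivWithinAt_const t S oneH).inner ℂ (hW c t ht)
    simp only [inner_oneH_left, inner_zero_left, add_zero] at h1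
    refine h1.congr_deriv ?_
    rw [← inner_oneH_left (lax _ _), ← neg_neg (inner ℂ oneH (lax _ _)),
      ← hskew, lax_oneH, inner_sub_left, inner_smul_left, inner_smul_left, inner_ksq,
      hksq c μ hc t ht, inner_smul_right, inner_oneH_left]
    simp only [map_mul, map_neg, map_div₀, Complex.conj_I, map_ofNat, conj_conj]
    ring
  refine ⟨fun f g => ?_, fun c => hkop c r hr, fun c μ hc => ?_, fun c μ hc h1 h2 => ?_⟩
  · simpa [hW1] using inner_eq_of_skew hS hskew (hW f) (hW g) hs hr
  · have h3 := eq_of_hasDerivWithinAt_zero (f := fun τ =>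
      inner ℂ (inner ℂ (emb (U τ)) (W τ c)) (inner ℂ (emb (U τ)) (W τ c))
        - (α : ℂ) * inner ℂ (W τ c 0) (W τ c 0)) hS (fun τ hτ => by
        have h4 := ((hX c μ hc τ hτ).inner ℂ (hX c μ hc τ hτ)).sub
          (((hY c μ hc τ hτ).inner ℂ (hY c μ hc τ hτ)).const_mul (α : ℂ))
        refine h4.congr_deriv ?_
        simp only [RCLike.inner_apply, map_add, map_sub, map_neg, map_mul, map_div₀,
          Complex.conj_I, map_ofNat, conj_conj, Complex.conj_ofReal]
        ring) hs hr
    have h5 : W s c = c := by rw [hW1]; rfl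
    simp only [h5, inner_self_eq_norm_sq_to_K] at h3
    refine Complex.ofReal_injective ?_
    push_cast
    exact h3
  · have h3 : ∀ t ∈ S, inner ℂ (emb (U t)) (W t c) = 0 ∧ W t c 0 = 0 := by
      intro t ht
      have h4 := eq_zero_of_norm_deriv_le (f := fun τ => (inner ℂ (emb (U τ)) (W τ c), W τ c 0))
        (K := |μ| + (|α| + 1) * B) hS
        (fun τ hτ => (hX c μ hc τ hτ).prodMk (hY c μ hc τ hτ)) (fun τ hτ => by
          have hu : ‖U τ 0‖ ≤ B := (norm_apply_le _ 0).trans (hB τ hτ)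
          have hB0 : 0 ≤ B := (norm_nonneg _).trans hu
          rw [Prod.norm_def, Prod.norm_def]
          set x := inner ℂ (emb (U τ)) (W τ c)
          set y := W τ c 0
          have hx := le_max_left ‖x‖ ‖y‖
          have hy := le_max_right ‖x‖ ‖y‖
          set m := max ‖x‖ ‖y‖
          have hm : 0 ≤ m := (norm_nonneg x).trans hx
          refine max_le ((norm_add_le _ _).trans ?_) ((norm_sub_le _ _).trans ?_)
          all_goals
            simp only [norm_mul, norm_neg, norm_div, Complex.norm_I, Complex.norm_real,
              Real.norm_eq_abs, RCLike.norm_conj, RCLike.norm_ofNat, one_mul]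
          · have h5 : |μ| * ‖x‖ ≤ |μ| * m := by gcongr
            have h6 : |α| * ‖U τ 0‖ * ‖y‖ ≤ |α| * B * m := by gcongr
            nlinarith [mul_nonneg (abs_nonneg μ) hm, mul_nonneg hB0 hm]
          · have h5 : |μ| * ‖y‖ ≤ |μ| * m := by gcongr
            have h6 : ‖U τ 0‖ * ‖x‖ ≤ B * m := by gcongr
            nlinarith [mul_nonneg (abs_nonneg μ) hm,
              mul_nonneg (mul_nonneg (abs_nonneg α) hB0) hm]) hs ht (by simp [hW1, h1, h2])
      simpa using h4
    refine ⟨(h3 r hr).1, (h3 r hr).2, sub_eq_zero.1 (eq_zero_of_skew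
      (f := fun τ => bshift 2 (W τ c) - W τ (bshift 2 c)) hS hskew (fun τ hτ => ?_) hs hr
      (by simp [hW1]))⟩
    have := (hasDerivWithinAt_clm (A := bshift 2) (hW c τ hτ)).sub (hW (bshift 2 c) τ hτ)
    refine this.congr_deriv ?_
    rw [bshift_lax, (h3 τ hτ).1, (h3 τ hτ).2, map_sub]
    simp

theorem norm_sub_le_of_bounded {α : ℝ} {U : ℝ → Wiener}
    (hU : ∀ n t, HasDerivAt (fun τ => U τ n) (field α (U t) n) t) {S : Set ℝ} (hS : Convex ℝ S)
    {B : ℝ} (hB : ∀ τ ∈ S, ‖U τ‖ ≤ B) {x y : ℝ} (hx : x ∈ S) (hy : y ∈ S) :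
    ‖U y - U x‖ ≤ (B ^ 3 + |α| * B) * ‖y - x‖ := by
  refine norm_sub_le_of_coeff_deriv (f' := fun τ => field α (U τ)) hS
    (fun n τ _ => (hU n τ).hasDerivWithinAt) (fun τ hτ => (norm_field_le α (U τ)).trans ?_) hx hy
  have := hB τ hτ
  gcongr

/-- On an interval where the `ℓ¹` norm is bounded, the flow transports spectral data. -/
theorem exists_transports {α : ℝ} {U : ℝ → Wiener}
    (hU : ∀ n t, HasDerivAt (fun τ => U τ n) (field α (U t) n) t) {s r : ℝ}
    {B : ℝ} (hB : ∀ τ ∈ uIcc s r, ‖U τ‖ ≤ B) :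
    ∃ W, Transports α (U s) (U r) W := by
  have hS : Convex ℝ (uIcc s r) := convex_uIcc s r
  have hc : ContinuousOn U (uIcc s r) := by
    refine LipschitzOnWith.continuousOn (K := (B ^ 3 + |α| * B).toNNReal)
      (LipschitzOnWith.of_dist_le_mul fun x hx y hy => ?_)
    rw [dist_eq_norm, dist_eq_norm]
    refine (norm_sub_le_of_bounded hU hS hB hy hx).trans ?_
    exact mul_le_mul_of_nonneg_right (Real.le_coe_toNNReal _) (norm_nonneg _)
  have hd : ∀ τ ∈ uIcc s r, HasDerivWithinAt U (field α (U τ)) (uIcc s r) τ := fun τ hτ =>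
    hasDerivWithinAt_of_coeff (f' := fun τ => field α (U τ)) hS
      (fun n τ _ => (hU n τ).hasDerivWithinAt) ((continuous_field α).comp_continuousOn hc) hτ
  have hl : ContinuousOn (fun τ => lax (U τ)) (uIcc s r) := continuous_lax.comp_continuousOn hc
  obtain ⟨K', hK'⟩ := isCompact_uIcc.exists_bound_of_continuousOn hl
  obtain ⟨K, hK1, hK⟩ : ∃ K : ℝ, 0 < K ∧ ∀ τ ∈ uIcc s r, ‖lax (U τ)‖ ≤ K :=
    ⟨max K' 1, by positivity, fun τ hτ => (hK' τ hτ).trans (le_max_left _ _)⟩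
  have step : ∀ a ∈ uIcc s r, ∀ b ∈ uIcc s r, K * |b - a| * 2 ≤ 1 →
      ∃ W, Transports α (U a) (U b) W := by
    intro a ha b hb hab
    have hsub : uIcc a b ⊆ uIcc s r := uIcc_subset_uIcc ha hb
    obtain ⟨W, hW1, hW⟩ := exists_propagator (hl.mono hsub) (fun τ hτ => hK τ (hsub hτ)) hab
    exact ⟨W b, Transports.of_propagator (convex_uIcc a b)
      (fun τ hτ => (hd τ (hsub hτ)).mono hsub) (fun τ hτ => hB τ (hsub hτ)) left_mem_uIcc
      right_mem_uIcc hW1 hW⟩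
  have main : ∀ n : ℕ, ∀ a ∈ uIcc s r, ∀ b ∈ uIcc s r, K * |b - a| * 2 ≤ n →
      ∃ W, Transports α (U a) (U b) W := by
    intro n
    induction n with
    | zero =>
      intro a _ b _ hab
      have h1 : |b - a| ≤ 0 := by
        by_contra! h
        have := mul_pos hK1 h
        norm_num at hab
        linarith
      have h2 : b = a := sub_eq_zero.1 (abs_nonpos_iff.1 h1)
      exact h2 ▸ ⟨1, Transports.refl α (U b)⟩
    | succ n ih =>
      intro a ha b hb hab
      push_cast at hab
      have hn : (0 : ℝ) < n + 1 := by positivity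
      set q : ℝ := a + (b - a) / (n + 1) with hq
      have hqm : q ∈ uIcc s r := by
        have := hS ha hb (a := (n : ℝ) / (n + 1)) (b := 1 / (n + 1)) (by positivity)
          (by positivity) (by field_simp)
        convert this using 1
        rw [hq, smul_eq_mul, smul_eq_mul]; field_simp; ring
      have h1 : |q - a| = |b - a| / (n + 1) := by
        rw [hq, add_sub_cancel_left, abs_div, abs_of_pos hn]
      have h2 : |b - q| = |b - a| * n / (n + 1) := by
        have : b - q = (b - a) * (n / (n + 1)) := by rw [hq]; field_simp; ring
        rw [this, abs_mul, abs_of_nonneg (by positivity : (0 : ℝ) ≤ n / (n + 1)), mul_div_assoc]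
      obtain ⟨V, hV⟩ := step a ha q hqm (by
        rw [h1, mul_div_assoc', div_mul_eq_mul_div, div_le_one hn]; exact hab)
      obtain ⟨W, hW⟩ := ih q hqm b hb (by
        rw [h2, mul_div_assoc', div_mul_eq_mul_div, div_le_iff₀ hn]
        nlinarith [(Nat.cast_nonneg n : (0 : ℝ) ≤ n)])
      exact ⟨_, hV.trans hW⟩
  obtain ⟨n, hn⟩ := exists_nat_ge (K * |r - s| * 2)
  exact main n s left_mem_uIcc r right_mem_uIcc hn

/-! ### Trace and Hilbert–Schmidt bounds -/

/-- The weighted `ℓ¹` norm `∑ (m + 1) |u_{m+1}|`. -/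
def wnorm (u : Wiener) : ℝ := ∑' m : ℕ, ((m : ℝ) + 1) * ‖u (m + 1)‖

theorem sum_norm_inner_kop_le {u : Wiener}
    (hu : Summable fun m : ℕ => ((m : ℝ) + 1) * ‖u (m + 1)‖) {A : ℝ} {f g : ℕ → Hardy}
    (hf : ∀ (i : ℕ) (F : Finset ℕ), ∑ n ∈ F, ‖f n i‖ ^ 2 ≤ A)
    (hg : ∀ (i : ℕ) (F : Finset ℕ), ∑ n ∈ F, ‖g n i‖ ^ 2 ≤ A) (F : Finset ℕ) :
    ∑ n ∈ F, ‖inner ℂ (kop u (f n)) (g n)‖ ≤ A * wnorm u := by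
  have hab : ∀ (G : Finset ℕ) (i j : ℕ), ∑ n ∈ G, ‖f n i‖ * ‖g n j‖ ≤ A := by
    intro G i j
    have h1 : ∑ n ∈ G, ‖f n i‖ * ‖g n j‖ ≤ ∑ n ∈ G, (‖f n i‖ ^ 2 + ‖g n j‖ ^ 2) / 2 :=
      Finset.sum_le_sum fun n _ => by nlinarith [sq_nonneg (‖f n i‖ - ‖g n j‖)]
    rw [← Finset.sum_div, Finset.sum_add_distrib] at h1
    linarith [hf i G, hg j G]
  have hb : ∀ (G : Finset ℕ) (m : ℕ), ∑ n ∈ G, ‖u (m + 1)‖ *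
      ∑ k ∈ Finset.range (m + 1), ‖f n (m - k)‖ * ‖g n k‖
      ≤ A * (((m : ℝ) + 1) * ‖u (m + 1)‖) := by
    intro G m
    rw [← Finset.mul_sum, Finset.sum_comm]
    have h1 := Finset.sum_le_sum fun k (_ : k ∈ Finset.range (m + 1)) => hab G (m - k) k
    rw [Finset.sum_const, Finset.card_range, nsmul_eq_mul] at h1
    push_cast at h1
    nlinarith [mul_le_mul_of_nonneg_left h1 (norm_nonneg (u (m + 1)))]
  have hs : ∀ n, Summable fun m : ℕ => ‖u (m + 1)‖ *
      ∑ k ∈ Finset.range (m + 1), ‖f n (m - k)‖ * ‖g n k‖ := fun n =>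
    Summable.of_nonneg_of_le (fun m => by positivity)
      (fun m => by simpa using hb {n} m) (hu.mul_left A)
  calc ∑ n ∈ F, ‖inner ℂ (kop u (f n)) (g n)‖
      ≤ ∑ n ∈ F, ∑' m : ℕ, ‖u (m + 1)‖ *
          ∑ k ∈ Finset.range (m + 1), ‖f n (m - k)‖ * ‖g n k‖ := by
        refine Finset.sum_le_sum fun n _ =>
          (hasSum_inner_kop u (f n) (g n)).norm_le_of_bounded (hs n).hasSum fun m => ?_
        rw [norm_mul, RCLike.norm_conj]
        refine mul_le_mul_of_nonneg_left ((norm_sum_le _ _).trans ?_) (norm_nonneg _)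
        exact Finset.sum_le_sum fun k _ => norm_mul_le _ _
    _ = ∑' m : ℕ, ∑ n ∈ F, ‖u (m + 1)‖ *
          ∑ k ∈ Finset.range (m + 1), ‖f n (m - k)‖ * ‖g n k‖ :=
        (Summable.tsum_finsetSum fun n _ => hs n).symm
    _ ≤ ∑' m : ℕ, A * (((m : ℝ) + 1) * ‖u (m + 1)‖) :=
        (summable_sum fun n _ => hs n).tsum_le_tsum (fun m => hb F m) (hu.mul_left A)
    _ = A * wnorm u := tsum_mul_left

/-- The standard basis of the Hardy space. -/
def basis (n : ℕ) : Hardy := lp.single 2 n 1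

theorem inner_basis_left (n : ℕ) (h : Hardy) : inner ℂ (basis n) h = h n :=
  (hardy_apply_eq_inner h n).symm

theorem norm_inner_basis_right (n : ℕ) (h : Hardy) : ‖inner ℂ h (basis n)‖ = ‖h n‖ := by
  rw [norm_inner_symm, inner_basis_left]

theorem norm_basis (n : ℕ) : ‖basis n‖ = 1 := by
  rw [basis, lp.norm_single (by simp), norm_one]

theorem orthonormal_basis : Orthonormal ℂ basis := by
  refine ⟨norm_basis, fun i j hij => ?_⟩
  change inner ℂ (basis i) (basis j) = 0
  rw [inner_basis_left, basis, lp.single_apply_ne _ _ _ hij]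

theorem kop_basis (u : Wiener) (n : ℕ) : kop u (basis n) = (bshift 2 ^ (n + 1)) (emb u) := by
  rw [basis, single_eq_shift_pow, kop_shift_pow, kop_oneH, pow_succ, mul_apply_eq_comp]

theorem kop_basis_apply (u : Wiener) (n k : ℕ) : kop u (basis n) k = u (k + n + 1) := by
  rw [kop_basis, bshift_pow_apply, emb_apply, add_assoc]

theorem Transports.orthonormal {α : ℝ} {u v : Wiener} {W : Hardy →L[ℂ] Hardy}
    (h : Transports α u v W) : Orthonormal ℂ fun n => W (basis n) := by
  rw [orthonormal_iff_ite]
  intro i j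
  rw [h.inner_map]
  exact orthonormal_iff_ite.1 orthonormal_basis i j

theorem sum_norm_apply_sq_le {f : ℕ → Hardy} (hf : Orthonormal ℂ f) (i : ℕ) (F : Finset ℕ) :
    ∑ n ∈ F, ‖f n i‖ ^ 2 ≤ 1 := by
  have := hf.sum_inner_products_le (basis i) (s := F)
  simpa [norm_inner_basis_right, norm_basis] using this

theorem tsum_le_of_even_odd {f : ℕ → ℝ} (hf : Summable f) {A : ℝ}
    (h : ∀ (j : ℕ) (F : Finset ℕ), ∑ n ∈ F, f (2 * n + j) ≤ A) : ∑' n, f n ≤ 2 * A := by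
  have h0 : Summable fun n => f (2 * n) :=
    hf.comp_injective (i := fun n => 2 * n) fun a b hab => by simp only at hab; omega
  have h1 : Summable fun n => f (2 * n + 1) :=
    hf.comp_injective (i := fun n => 2 * n + 1) fun a b hab => by simp only at hab; omega
  rw [← tsum_even_add_odd h0 h1, two_mul]
  exact add_le_add (h0.tsum_le_of_sum_le (h 0)) (h1.tsum_le_of_sum_le (h 1))

theorem Wiener.norm_le_of_even_odd {u : Wiener} {A : ℝ}
    (h : ∀ (j : ℕ) (F : Finset ℕ), ∑ n ∈ F, ‖u (2 * n + j + 1)‖ ≤ A) :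
    ‖u‖ ≤ ‖u 0‖ + 2 * A := by
  rw [u.norm_eq, u.summable_norm.tsum_eq_zero_add]
  have := tsum_le_of_even_odd ((summable_nat_add_iff 1).2 u.summable_norm) h
  linarith

/-- The `ℓ¹` norm is controlled along the flow by the trace norm of `K_u`. -/
theorem Transports.norm_le {α : ℝ} {u v : Wiener} {W : Hardy →L[ℂ] Hardy}
    (h : Transports α u v W) (hv : Summable fun m : ℕ => ((m : ℝ) + 1) * ‖v (m + 1)‖) :
    ‖u‖ ≤ ‖u 0‖ + 2 * wnorm v := by
  refine Wiener.norm_le_of_even_odd fun j F => ?_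
  have hg : Orthonormal ℂ fun n => W (basis (n + j)) :=
    h.orthonormal.comp (fun n => n + j) (add_left_injective j)
  have h1 := sum_norm_inner_kop_le hv (A := 1) (f := fun n => W (basis n))
    (g := fun n => W (basis (n + j))) (sum_norm_apply_sq_le h.orthonormal)
    (sum_norm_apply_sq_le hg) F
  rw [one_mul] at h1
  refine le_trans (le_of_eq (Finset.sum_congr rfl fun n _ => ?_)) h1
  have h2 : inner ℂ (kop v (W (basis n))) (W (basis (n + j)))
      = inner ℂ (kop u (basis n)) (basis (n + j)) := by rw [h.kop_map, h.inner_map]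
  rw [h2, norm_inner_basis_right, kop_basis_apply, show 2 * n + j + 1 = n + j + n + 1 by ring]

/-- Uniform decay of the tails from the Hilbert–Schmidt norm of `K_u`. -/
theorem Transports.tail_le {α : ℝ} {u v : Wiener} {W : Hardy →L[ℂ] Hardy}
    (h : Transports α u v W) (hv : Summable fun m : ℕ => ((m : ℝ) + 1) * ‖v (m + 1)‖) (J : ℕ) :
    J * ‖(bshift 2 ^ J) (emb u)‖ ^ 2 ≤ max 1 (‖v‖ ^ 2) * wnorm v := by
  have hg : ∀ (i : ℕ) (F : Finset ℕ), ∑ n ∈ F, ‖kop v (W (basis n)) i‖ ^ 2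
      ≤ max 1 (‖v‖ ^ 2) := by
    intro i F
    have h2 := h.orthonormal.sum_inner_products_le (kop v (basis i)) (s := F)
    have h3 : ‖kop v (basis i)‖ ≤ ‖v‖ := by simpa [norm_basis] using norm_kop_le v (basis i)
    refine le_trans (le_of_eq (Finset.sum_congr rfl fun n _ => ?_))
      (h2.trans ((pow_le_pow_left₀ (norm_nonneg _) h3 2).trans (le_max_right _ _)))
    rw [← norm_inner_basis_right, inner_kop_comm, norm_inner_symm]
  have h1 := sum_norm_inner_kop_le hv (A := max 1 (‖v‖ ^ 2)) (f := fun n => W (basis n))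
      (g := fun n => kop v (W (basis n)))
      (fun i F => (sum_norm_apply_sq_le h.orthonormal i F).trans (le_max_left _ _)) hg
      (Finset.range J)
  refine le_trans ?_ h1
  have h4 := Finset.card_nsmul_le_sum (Finset.range J)
    (fun n => ‖inner ℂ (kop v (W (basis n))) (kop v (W (basis n)))‖)
    (‖(bshift 2 ^ J) (emb u)‖ ^ 2) fun n hn => ?_
  · rwa [Finset.card_range, nsmul_eq_mul] at h4
  have h5 : inner ℂ (kop v (W (basis n))) (kop v (W (basis n)))
      = inner ℂ (kop u (basis n)) (kop u (basis n)) := by rw [h.kop_map, h.inner_map]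
  obtain ⟨k, rfl⟩ := Nat.exists_eq_add_of_le (Nat.succ_le_of_lt (Finset.mem_range.1 hn))
  rw [h5, inner_self_eq_norm_sq_to_K, kop_basis, norm_pow, RCLike.norm_ofReal, abs_norm,
    Nat.succ_eq_add_one, Nat.add_comm, pow_add, mul_apply_eq_comp]
  gcongr
  have h6 := (bshift 2 ^ k).le_of_opNorm_le (norm_bshift_pow_le 2 k) ((bshift 2 ^ (n + 1)) (emb u))
  rwa [one_mul] at h6

theorem exists_bound_of_locally_bounded {y : ℝ → ℝ} {K : Set ℝ} (hK : IsCompact K)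
    (h : ∀ t ∈ K, ∃ B, ∀ᶠ τ in 𝓝 t, y τ ≤ B) : ∃ B, ∀ t ∈ K, y t ≤ B := by
  refine hK.induction_on (p := fun s => ∃ B, ∀ t ∈ s, y t ≤ B) ⟨0, by simp⟩
    (fun s t hst ⟨B, hB⟩ => ⟨B, fun x hx => hB x (hst hx)⟩)
    (fun s t ⟨B, hB⟩ ⟨C, hC⟩ => ⟨max B C, fun x hx => hx.elim
      (fun hx => (hB x hx).trans (le_max_left _ _)) fun hx => (hC x hx).trans (le_max_right _ _)⟩)
    fun t ht => ?_
  obtain ⟨B, hB⟩ := h t ht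
  exact ⟨_, mem_nhdsWithin_of_mem_nhds hB, B, fun x hx => hx⟩

/-- The properties of the norm of a solution that exclude blow-up: it is Lipschitz where it is
bounded, lower semicontinuous, and controlled along intervals of boundedness. -/
structure Controlled (y : ℝ → ℝ) (κ z D : ℝ → ℝ) : Prop where
  lipschitz : ∀ s r B, (∀ τ ∈ uIcc s r, y τ ≤ B) → |y s - y r| ≤ κ B * |s - r|
  isClosed : ∀ M, IsClosed {t | y t ≤ M}
  le : ∀ s r B, (∀ τ ∈ uIcc s r, y τ ≤ B) → y r ≤ z r + D s
  continuous : Continuous z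

namespace Controlled

variable {y κ z D : ℝ → ℝ}

theorem comp_neg (h : Controlled y κ z D) :
    Controlled (fun t => y (-t)) κ (fun t => z (-t)) (fun t => D (-t)) := by
  have aux : ∀ {s r B}, (∀ τ ∈ uIcc s r, y (-τ) ≤ B) → ∀ τ ∈ uIcc (-s) (-r), y τ ≤ B := by
    intro s r B hB τ hτ
    have := hB (-τ) (by
      rw [mem_uIcc] at hτ ⊢
      rcases hτ with hτ | hτ
      · right; constructor <;> linarith
      · left; constructor <;> linarith)
    rwa [neg_neg] at this
  refine ⟨fun s r B hB => ?_, fun M => (h.isClosed M).preimage continuous_neg,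
    fun s r B hB => h.le _ _ B (aux hB), h.continuous.comp continuous_neg⟩
  have := h.lipschitz _ _ B (aux hB)
  rwa [← neg_add', abs_neg, ← sub_eq_add_neg] at this

theorem exists_right (h : Controlled y κ z D) {S : Set ℝ} (hS : IsClosed S)
    (hloc : ∀ t ∉ S, ∃ B, ∀ᶠ τ in 𝓝 t, y τ ≤ B) {t₀ δ M : ℝ} (ht₀ : t₀ ∈ S) (hδ : 0 < δ)
    (hM : ∀ t ∈ S, |t - t₀| < δ → y t ≤ M) :
    ∃ δ' > 0, ∀ t ∈ Icc t₀ (t₀ + δ'), y t ≤ M + 1 := by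
  have hκ : 0 < |κ (M + 1)| + 1 := by positivity
  refine ⟨min (δ / 2) (1 / (2 * (|κ (M + 1)| + 1))), by positivity, fun t ht => ?_⟩
  have ht1 : t - t₀ ≤ δ / 2 := by linarith [ht.2, min_le_left (δ / 2) (1 / (2 * (|κ (M + 1)| + 1)))]
  have ht2 : t - t₀ ≤ 1 / (2 * (|κ (M + 1)| + 1)) := by
    linarith [ht.2, min_le_right (δ / 2) (1 / (2 * (|κ (M + 1)| + 1)))]
  by_contra! hyt
  have hMS : ∀ a ∈ S, t₀ ≤ a → a ≤ t → y a ≤ M := fun a ha h1 h2 =>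
    hM a ha (by rw [abs_of_nonneg (by linarith)]; linarith)
  have hcpt : IsCompact (S ∩ Icc t₀ t) := isCompact_Icc.inter_left hS
  obtain ⟨haS, ha0, hat⟩ := hcpt.sSup_mem ⟨t₀, ht₀, left_mem_Icc.2 ht.1⟩
  have hsup : ∀ b ∈ S, t₀ ≤ b → b ≤ t → b ≤ sSup (S ∩ Icc t₀ t) := fun b hb h1 h2 =>
    le_csSup hcpt.bddAbove ⟨hb, h1, h2⟩
  set a := sSup (S ∩ Icc t₀ t)
  have hya : y a ≤ M := hMS a haS ha0 hat
  have hmid : ∀ b, a < b → b ≤ t → b ∉ S := fun b h1 h2 hb =>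
    (hsup b hb (ha0.trans h1.le) h2).not_gt h1
  obtain ⟨Z, hZ⟩ := isCompact_Icc.bddAbove_image (h.continuous.continuousOn (s := Icc a t))
  have hbd : ∀ τ ∈ Icc a t, y τ ≤ max M (Z + D t) := by
    intro τ hτ
    rcases hτ.1.eq_or_lt with rfl | hlt
    · exact hya.trans (le_max_left _ _)
    obtain ⟨B, hB⟩ := exists_bound_of_locally_bounded (y := y) (K := Icc τ t) isCompact_Icc
      fun b hb => hloc b (hmid b (hlt.trans_le hb.1) hb.2)
    have := h.le t τ B (by rwa [uIcc_of_ge hτ.2])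
    exact (this.trans (add_le_add_left (hZ (mem_image_of_mem z hτ)) _)).trans (le_max_right _ _)
  have hcont : ContinuousOn y (Icc a t) := by
    refine (LipschitzOnWith.of_dist_le_mul
      (K := Real.toNNReal (κ (max M (Z + D t)))) ?_).continuousOn
    intro s hs r hr
    rw [Real.dist_eq, Real.dist_eq]
    refine (h.lipschitz s r _ fun τ hτ => hbd τ (ordConnected_Icc.uIcc_subset hs hr hτ)).trans ?_
    exact mul_le_mul_of_nonneg_right (Real.le_coe_toNNReal _) (abs_nonneg _)
  have hC : IsCompact (Icc a t ∩ y ⁻¹' Ici (M + 1)) :=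
    isCompact_Icc.of_isClosed_subset (hcont.preimage_isClosed_of_isClosed isClosed_Icc isClosed_Ici)
      inter_subset_left
  obtain ⟨⟨hac, hct⟩, hyc⟩ := hC.sInf_mem ⟨t, right_mem_Icc.2 hat, hyt.le⟩
  have hinf : ∀ b ∈ Icc a t, M + 1 ≤ y b → sInf (Icc a t ∩ y ⁻¹' Ici (M + 1)) ≤ b :=
    fun b hb h1 => csInf_le hC.bddBelow ⟨hb, h1⟩
  set c := sInf (Icc a t ∩ y ⁻¹' Ici (M + 1))
  have hyc : M + 1 ≤ y c := hyc
  have hne : a ≠ c := fun e => by rw [← e] at hyc; linarith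
  have hsub : Icc a c ⊆ {τ | y τ ≤ M + 1} := by
    rw [← closure_Ico hne]
    refine (h.isClosed _).closure_subset_iff.2 fun τ hτ => ?_
    by_contra hlt
    exact (hinf τ ⟨hτ.1, hτ.2.le.trans hct⟩ (not_le.1 hlt).le).not_gt hτ.2
  have hlip := h.lipschitz a c (M + 1) (by rw [uIcc_of_le hac]; exact fun τ hτ => hsub hτ)
  have h1 : |a - c| ≤ 1 / (2 * (|κ (M + 1)| + 1)) := by
    rw [abs_sub_comm, abs_of_nonneg (by linarith)]; linarith
  have h2 : κ (M + 1) * |a - c| ≤ 1 / 2 := by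
    calc κ (M + 1) * |a - c| ≤ (|κ (M + 1)| + 1) * |a - c| := by
          gcongr; linarith [le_abs_self (κ (M + 1))]
      _ ≤ (|κ (M + 1)| + 1) * (1 / (2 * (|κ (M + 1)| + 1))) := by gcongr
      _ = 1 / 2 := by field_simp
  have h3 := neg_abs_le (y a - y c)
  linarith

theorem locally_bounded (h : Controlled y κ z D) (t : ℝ) : ∃ B, ∀ᶠ τ in 𝓝 t, y τ ≤ B := by
  set S : Set ℝ := {t | ∃ B, ∀ᶠ τ in 𝓝 t, y τ ≤ B}ᶜ with hS
  suffices hemp : S = ∅ by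
    by_contra ht
    have : t ∈ S := ht
    simp [hemp] at this
  have hloc : ∀ t ∉ S, ∃ B, ∀ᶠ τ in 𝓝 t, y τ ≤ B := fun t ht => not_not.1 ht
  have hcl : IsClosed S := by
    rw [hS, isClosed_compl_iff, isOpen_iff_eventually]
    rintro t ⟨B, hB⟩
    filter_upwards [eventually_eventually_nhds.2 hB] with τ hτ using ⟨B, hτ⟩
  by_contra hne
  have : Nonempty S := (nonempty_iff_ne_empty.2 hne).to_subtype
  have : CompleteSpace S := hcl.completeSpace_coe
  obtain ⟨M, ⟨t₀, ht₀⟩, hx⟩ := nonempty_interior_of_iUnion_of_closed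
    (f := fun M : ℕ => {x : S | y x ≤ M})
    (fun M => (h.isClosed M).preimage continuous_subtype_val)
    (eq_univ_of_forall fun x => mem_iUnion.2 (exists_nat_ge (y x)))
  obtain ⟨δ, hδ, hball⟩ := Metric.mem_nhds_iff.1 (mem_interior_iff_mem_nhds.1 hx)
  have hM : ∀ t ∈ S, |t - t₀| < δ → y t ≤ M := fun t ht hd =>
    hball (a := ⟨t, ht⟩) (by rwa [Metric.mem_ball, Subtype.dist_eq, Real.dist_eq])
  obtain ⟨δ₁, hδ₁, h₁⟩ := h.exists_right hcl hloc ht₀ hδ hM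
  obtain ⟨δ₂, hδ₂, h₂⟩ := h.comp_neg.exists_right (S := -S) (t₀ := -t₀)
    (hcl.preimage continuous_neg)
    (fun t ht => by
      obtain ⟨B, hB⟩ := hloc (-t) ht
      exact ⟨B, (continuous_neg.tendsto t).eventually hB⟩)
    (by simpa using ht₀) hδ (M := M) fun t ht hd => hM (-t) ht (by
      rw [← abs_neg]; convert hd using 2; ring)
  refine ht₀ ⟨M + 1, ?_⟩
  filter_upwards [Ioo_mem_nhds (sub_lt_self t₀ hδ₂) (lt_add_of_pos_right t₀ hδ₁)] with τ hτ
  rcases le_total t₀ τ with hle | hle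
  · exact h₁ τ ⟨hle, hτ.2.le⟩
  · simpa using h₂ (-τ) ⟨by linarith, by linarith [hτ.1]⟩

theorem exists_bound (h : Controlled y κ z D) (s r : ℝ) : ∃ B, ∀ τ ∈ uIcc s r, y τ ≤ B :=
  exists_bound_of_locally_bounded isCompact_uIcc fun t _ => h.locally_bounded t

end Controlled

theorem controlled_norm {α : ℝ} {U : ℝ → Wiener}
    (hU : ∀ n t, HasDerivAt (fun τ => U τ n) (field α (U t) n) t)
    (hw : ∀ t, Summable fun m : ℕ => ((m : ℝ) + 1) * ‖U t (m + 1)‖) :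
    Controlled (fun t => ‖U t‖) (fun B => B ^ 3 + |α| * B) (fun t => ‖U t 0‖)
      (fun t => 2 * wnorm (U t)) := by
  have hc : ∀ n, Continuous fun t => U t n := fun n =>
    continuous_iff_continuousAt.2 fun t => (hU n t).continuousAt
  refine ⟨fun s r B hB => ?_, fun M => ?_, fun s r B hB => ?_, (hc 0).norm⟩
  · rw [← Real.norm_eq_abs (s - r)]
    exact (abs_norm_sub_norm_le _ _).trans (norm_sub_le_of_bounded hU (convex_uIcc s r) hB
      right_mem_uIcc left_mem_uIcc)
  · have : {t | ‖U t‖ ≤ M} = ⋂ F : Finset ℕ, {t | ∑ n ∈ F, ‖U t n‖ ≤ M} := by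
      ext t
      simp only [mem_iInter, mem_ofPred_eq]
      rw [(U t).norm_eq]
      exact ⟨fun h F => ((U t).summable_norm.sum_le_tsum F fun _ _ => norm_nonneg _).trans h,
        (U t).summable_norm.tsum_le_of_sum_le⟩
    rw [this]
    exact isClosed_iInter fun F => isClosed_le (by fun_prop) continuous_const
  · obtain ⟨W, hW⟩ := exists_transports hU (s := r) (r := s) (B := B) (by rwa [uIcc_comm])
    exact hW.norm_le (hw s)

theorem exists_transports_of_summable {α : ℝ} {U : ℝ → Wiener}
    (hU : ∀ n t, HasDerivAt (fun τ => U τ n) (field α (U t) n) t)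
    (hw : ∀ t, Summable fun m : ℕ => ((m : ℝ) + 1) * ‖U t (m + 1)‖) (s r : ℝ) :
    ∃ W, Transports α (U s) (U r) W :=
  let ⟨_, hB⟩ := (controlled_norm hU hw).exists_bound s r
  exists_transports hU hB

end Szego

namespace Szego

theorem bshift_pow_apply_hardy (k n : ℕ) (h : Hardy) : (bshift 2 ^ k) h n = h (n + k) :=
  bshift_pow_apply ..

theorem norm_bshift_pow_apply_le (k : ℕ) (h : Hardy) : ‖(bshift 2 ^ k) h‖ ≤ ‖h‖ := by
  simpa using (bshift 2 ^ k).le_of_opNorm_le (norm_bshift_pow_le 2 k) h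

theorem hasSum_inner_hardy (x h : Hardy) : HasSum (fun n => conj (x n) * h n) (inner ℂ x h) := by
  simpa [mul_comm] using lp.hasSum_inner (𝕜 := ℂ) x h

theorem inner_sub_sum_range (x h : Hardy) (J : ℕ) :
    inner ℂ x h - ∑ n ∈ Finset.range J, conj (x n) * h n
      = inner ℂ ((bshift 2 ^ J) x) ((bshift 2 ^ J) h) := by
  have h1 := hasSum_inner_hardy ((bshift 2 ^ J) x) ((bshift 2 ^ J) h)
  simp only [bshift_pow_apply_hardy] at h1
  have h2 := (hasSum_inner_hardy x h).summable.sum_add_tsum_nat_add J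
  rw [h1.tsum_eq, (hasSum_inner_hardy x h).tsum_eq] at h2
  rw [← h2, add_sub_cancel_left]

/-- Strong–weak convergence: the inner product passes to coefficientwise limits when one factor is
bounded and the other has uniformly decaying tails. -/
theorem tendsto_inner_of_tail {l : Filter ℕ} {x h : ℕ → Hardy} {x' h' : Hardy} {Θ C : ℝ}
    (hx : ∀ (n J : ℕ), J * ‖(bshift 2 ^ J) (x n)‖ ^ 2 ≤ Θ) (hh : ∀ n, ‖h n‖ ≤ C)
    (hx' : ∀ k, Tendsto (fun n => x n k) l (𝓝 (x' k)))
    (hh' : ∀ k, Tendsto (fun n => h n k) l (𝓝 (h' k))) :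
    Tendsto (fun n => inner ℂ (x n) (h n)) l (𝓝 (inner ℂ x' h')) := by
  have hC : 0 ≤ C := (norm_nonneg _).trans (hh 0)
  have hunif : TendstoUniformly (fun (J : ℕ) n => ∑ k ∈ Finset.range J, conj (x n k) * h n k)
      (fun n => inner ℂ (x n) (h n)) atTop := by
    rw [Metric.tendstoUniformly_iff]
    intro ε hε
    obtain ⟨J₀, hJ₀⟩ := exists_nat_gt (Θ * C ^ 2 / ε ^ 2)
    filter_upwards [eventually_ge_atTop (max J₀ 1)] with J hJ n
    have hJ1 : (J₀ : ℝ) ≤ J := by exact_mod_cast (le_max_left _ _).trans hJ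
    have hJ2 : (0 : ℝ) < J := by exact_mod_cast (le_max_right J₀ 1).trans hJ
    rw [dist_eq_norm, inner_sub_sum_range]
    refine (norm_inner_le_norm _ _).trans_lt ?_
    have h1 : Θ * C ^ 2 < J * ε ^ 2 := by
      rw [div_lt_iff₀ (by positivity)] at hJ₀
      exact hJ₀.trans_le (by gcongr)
    have h2 := (norm_bshift_pow_apply_le J (h n)).trans (hh n)
    have h3 : (‖(bshift 2 ^ J) (x n)‖ * C) ^ 2 < ε ^ 2 := by
      have := mul_le_mul_of_nonneg_right (hx n J) (sq_nonneg C)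
      refine lt_of_mul_lt_mul_left ?_ hJ2.le
      rw [mul_pow, ← mul_assoc]
      linarith
    exact (mul_le_mul_of_nonneg_left h2 (norm_nonneg _)).trans_lt
      (lt_of_pow_lt_pow_left₀ 2 hε.le h3)
  refine hunif.tendsto_of_eventually_tendsto (.of_forall fun J => ?_)
    (hasSum_inner_hardy x' h').tendsto_sum_nat
  exact tendsto_finsetSum _ fun k _ =>
    ((Complex.continuous_conj.tendsto _).comp (hx' k)).mul (hh' k)

theorem exists_tendsto_coeff (l : Ultrafilter ℕ) {h : ℕ → Hardy} {C : ℝ} (hC : ∀ n, ‖h n‖ ≤ C) :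
    ∃ g : Hardy, ∀ k, Tendsto (fun n => h n k) l (𝓝 (g k)) := by
  have h1 : ∀ k, ∃ z : ℂ, Tendsto (fun n => h n k) l (𝓝 z) := by
    intro k
    obtain ⟨z, -, hz⟩ := (isCompact_closedBall (0 : ℂ) C).ultrafilter_le_nhds'
      (l.map fun n => h n k) (Ultrafilter.mem_map.2 (Filter.mem_of_superset Filter.univ_mem
        fun n _ => by simpa using (lp.norm_apply_le_norm (by simp) (h n) k).trans (hC n)))
    exact ⟨z, hz⟩
  choose g hg using h1
  refine ⟨⟨g, lp.memℓp_of_tendsto (F := h) (l := (l : Filter ℕ)) ?_ (tendsto_pi_nhds.2 hg)⟩, hg⟩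
  exact isBounded_iff_forall_norm_le.2 ⟨C, by rintro _ ⟨n, rfl⟩; exact hC n⟩

theorem Transports.norm_map {α : ℝ} {u v : Wiener} {W : Hardy →L[ℂ] Hardy}
    (h : Transports α u v W) (c : Hardy) : ‖W c‖ = ‖c‖ := by
  rw [@norm_eq_sqrt_re_inner ℂ, h.inner_map, ← @norm_eq_sqrt_re_inner ℂ]

/-- The weak limit of isometries along an ultrafilter. -/
theorem exists_weak_limit (l : Ultrafilter ℕ) {W : ℕ → Hardy →L[ℂ] Hardy}
    (hW : ∀ n c, ‖W n c‖ ≤ ‖c‖) :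
    ∃ V : Hardy →ₗ[ℂ] Hardy, ∀ c k, Tendsto (fun n => W n c k) l (𝓝 (V c k)) := by
  choose V hV using fun c => exists_tendsto_coeff l fun n => hW n c
  refine ⟨⟨⟨V, fun f g => ?_⟩, fun a f => ?_⟩, hV⟩
  · ext k
    refine tendsto_nhds_unique (hV (f + g) k) (((hV f k).add (hV g k)).congr fun n => ?_)
    rw [map_add, lp.coeFn_add, Pi.add_apply]
  · ext k
    refine tendsto_nhds_unique (hV (a • f) k) (((hV f k).const_mul a).congr fun n => ?_)
    rw [map_smul, lp.coeFn_smul, Pi.smul_apply, smul_eq_mul]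

theorem khankel_eq_inner (x h : Hardy) (k : ℕ) :
    khankel x h k = inner ℂ h ((bshift 2 ^ (k + 1)) x) := by
  refine ((hasSum_inner_hardy h ((bshift 2 ^ (k + 1)) x)).congr_fun fun l => ?_).tsum_eq
  rw [bshift_pow_apply_hardy, mul_comm, add_comm]

/-- The weak limit of transports intertwines the Hankel operators. -/
theorem khankel_weak_limit {l : Filter ℕ} [l.NeBot] {α Θ : ℝ} {u : Wiener} {v : ℕ → Wiener}
    {W : ℕ → Hardy →L[ℂ] Hardy} (hW : ∀ n, Transports α u (v n) (W n))
    (hv : ∀ (n J : ℕ), J * ‖(bshift 2 ^ J) (emb (v n))‖ ^ 2 ≤ Θ) {x : Hardy}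
    (hx : ∀ k, Tendsto (fun n => v n k) l (𝓝 (x k))) {V : Hardy →ₗ[ℂ] Hardy}
    (hV : ∀ c k, Tendsto (fun n => W n c k) l (𝓝 (V c k))) (c : Hardy) :
    khankel x (V c) = V (kop u c) := by
  funext k
  refine tendsto_nhds_unique ?_ (hV (kop u c) k)
  have h1 : ∀ n, W n (kop u c) k = conj (inner ℂ ((bshift 2 ^ (k + 1)) (emb (v n))) (W n c)) := by
    intro n
    rw [← (hW n).kop_map, kop_coe, inner_conj_symm, ← khankel_eq_inner]
    congr 1
    exact funext fun m => (emb_apply _ _).symm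
  simp only [h1]
  rw [khankel_eq_inner, ← inner_conj_symm]
  refine (Complex.continuous_conj.tendsto _).comp (tendsto_inner_of_tail (Θ := Θ) (C := ‖c‖)
    (fun n J => ?_) (fun n => ((hW n).norm_map c).le) (fun m => ?_) (hV c))
  · refine le_trans ?_ (hv n J)
    rw [← mul_apply_eq_comp, ← pow_add, add_comm, pow_add, mul_apply_eq_comp]
    gcongr
    exact norm_bshift_pow_apply_le _ _
  · simpa only [bshift_pow_apply_hardy, emb_apply] using hx _

theorem ksq_kop (u : Wiener) {c : Hardy} {μ : ℝ} (hc : ksq u c = (μ : ℂ) • c) :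
    ksq u (kop u c) = (μ : ℂ) • kop u c := by
  rw [ksq_apply, ← ksq_apply u c, hc, kop_smul, Complex.conj_ofReal]

/-- On an eigenspace of `K_u²` the functionals `(·|u)` and `(·|1)` are collinear. -/
theorem inner_emb_mul_apply_zero (u : Wiener) {f g : Hardy} {μ : ℝ} (hμ : μ ≠ 0)
    (hf : ksq u f = (μ : ℂ) • f) (hg : ksq u g = (μ : ℂ) • g) :
    inner ℂ (emb u) f * g 0 = f 0 * inner ℂ (emb u) g := by
  have h1 : inner ℂ (kop u g) (ksq u (bshift 2 f)) = (μ : ℂ) * inner ℂ (kop u g) (bshift 2 f) := by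
    rw [← inner_ksq, ksq_kop u hg, inner_smul_left, Complex.conj_ofReal]
  rw [ksq_bshift, hf, map_smul, inner_sub_right, inner_add_right, inner_smul_right,
    inner_smul_right, inner_smul_right, ← kop_oneH, add_sub_assoc, add_eq_left, sub_eq_zero] at h1
  have h2 : ∀ w, inner ℂ (kop u g) (kop u w) = (μ : ℂ) * inner ℂ w g := by
    intro w
    rw [inner_kop_comm, ← ksq_apply, inner_ksq, hg, inner_smul_right]
  rw [h2, h2, inner_oneH_left] at h1
  have h3 : (μ : ℂ) ≠ 0 := by exact_mod_cast hμ
  refine mul_left_cancel₀ h3 ?_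
  linear_combination h1

/-- A non-degenerate eigenspace carries no common isotropic vector except those orthogonal
to `u` and `1`. -/
theorem apply_zero_eq_zero_of_isotropic {α : ℝ} (u : Wiener) {c p q : Hardy} {μ : ℝ} (hμ : μ ≠ 0)
    (hc : ksq u c = (μ : ℂ) • c) (hp : ksq u p = (μ : ℂ) • p) (hq : ksq u q = (μ : ℂ) • q)
    (hp' : ∀ f, ksq u f = (μ : ℂ) • f → inner ℂ p f = inner ℂ (emb u) f)
    (hq' : ∀ f, ksq u f = (μ : ℂ) • f → inner ℂ q f = f 0)
    (hpq : ‖p‖ ^ 2 - α * ‖q‖ ^ 2 ≠ 0) (hiso : ‖inner ℂ (emb u) c‖ ^ 2 = α * ‖c 0‖ ^ 2) :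
    c 0 = 0 := by
  by_contra hne
  have h1 := inner_emb_mul_apply_zero u hμ hp hq
  have h2 := inner_emb_mul_apply_zero u hμ hc hp
  rw [← hp' p hp, ← hq' q hq, ← hp' q hq, ← hq' p hp, inner_self_eq_norm_sq_to_K,
    inner_self_eq_norm_sq_to_K] at h1
  rw [← hp' p hp, inner_self_eq_norm_sq_to_K, ← hq' p hp] at h2
  have e1 := congrArg norm h1
  have e2 := congrArg norm h2
  simp only [norm_mul, norm_pow, RCLike.norm_ofReal, abs_norm] at e1 e2
  rw [norm_inner_symm p q] at e1
  have hc0 : 0 < ‖c 0‖ := norm_pos_iff.2 hne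
  by_cases hp0 : ‖p‖ = 0
  · have h3 := hp' c hc
    rw [norm_eq_zero.1 hp0, inner_zero_left] at h3
    rw [← h3, norm_zero] at hiso
    have hα : α = 0 := by
      have : α * ‖c 0‖ ^ 2 = 0 := by rw [← hiso]; norm_num
      exact (mul_eq_zero.1 this).resolve_right (by positivity)
    rw [hp0, hα] at hpq
    norm_num at hpq
  · refine hpq ?_
    have e3 : ‖c 0‖ ^ 2 * ‖p‖ ^ 2 * (‖p‖ ^ 2 - α * ‖q‖ ^ 2) = 0 := by
      have e4 : ‖inner ℂ (emb u) c‖ ^ 2 * ‖inner ℂ q p‖ ^ 2 = ‖c 0‖ ^ 2 * (‖p‖ ^ 2) ^ 2 := by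
        rw [← mul_pow, e2, mul_pow]
      rw [hiso, pow_two ‖inner ℂ q p‖, ← e1] at e4
      linear_combination -e4
    exact (mul_eq_zero.1 e3).resolve_left (by positivity)

/-- The range of `K_u` on the Hardy space. -/
def kopRange (u : Wiener) : Submodule ℂ Hardy where
  carrier := Set.range (kop u)
  add_mem' := by
    rintro _ _ ⟨f, rfl⟩ ⟨g, rfl⟩
    exact ⟨f + g, kop_add u f g⟩
  zero_mem' := ⟨0, kop_zero u⟩
  smul_mem' := by
    rintro a _ ⟨f, rfl⟩
    exact ⟨conj a • f, by rw [kop_smul, Complex.conj_conj]⟩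

/-- Fourier coefficients as a linear map. -/
def coeffs : Hardy →ₗ[ℂ] ℕ → ℂ where
  toFun h := h
  map_add' := lp.coeFn_add
  map_smul' := lp.coeFn_smul

theorem coeffs_injective : Function.Injective coeffs := fun _ _ h => lp.ext h

theorem map_coeffs_kopRange (u : Wiener) :
    (kopRange u).map coeffs = Submodule.span ℂ (khankel u '' {h | MemL2 h}) := by
  refine le_antisymm ?_ (Submodule.span_le.2 ?_)
  · rintro _ ⟨_, ⟨f, rfl⟩, rfl⟩
    exact Submodule.subset_span ⟨f, lp.memℓp f, (kop_coe u f).symm⟩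
  · rintro _ ⟨f, hf, rfl⟩
    exact ⟨kop u ⟨f, hf⟩, ⟨_, rfl⟩, kop_coe u ⟨f, hf⟩⟩

theorem kuRank_eq (u : Wiener) : kuRank u = Module.rank ℂ (kopRange u) := by
  rw [kuRank, ← map_coeffs_kopRange]
  exact (Submodule.equivMapOfInjective coeffs coeffs_injective _).rank_eq.symm

theorem exists_ker_of_kuRank_lt {u : Wiener} {x : Hardy} {V : Hardy →ₗ[ℂ] Hardy}
    (hV : ∀ c, khankel x (V c) = V (kop u c)) (hlt : kuRank x < kuRank u) :
    ∃ c ∈ kopRange u, c ≠ 0 ∧ V c = 0 := by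
  by_contra! hno
  refine hlt.not_ge ?_
  rw [kuRank_eq, kuRank]
  have hmem : ∀ c : kopRange u, (coeffs ∘ₗ V ∘ₗ (kopRange u).subtype) c
      ∈ Submodule.span ℂ (khankel x '' {h | MemL2 h}) := by
    rintro ⟨_, ⟨f, rfl⟩⟩
    exact Submodule.subset_span ⟨V f, lp.memℓp _, hV f⟩
  refine LinearMap.rank_le_of_injective (LinearMap.codRestrict _ _ hmem) ?_
  rw [← LinearMap.ker_eq_bot, LinearMap.ker_codRestrict, LinearMap.ker_eq_bot']
  intro c hc
  by_contra hne
  exact hno c c.2 (fun h => hne (Subtype.ext h)) (coeffs_injective (hc.trans (map_zero _).symm))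

theorem inner_ksq_self (u : Wiener) (c : Hardy) : inner ℂ c (ksq u c) = (‖kop u c‖ : ℂ) ^ 2 := by
  rw [← inner_ksq, ksq_apply, inner_kop_comm, inner_self_eq_norm_sq_to_K]; rfl

theorem eq_zero_of_mem_kopRange {u : Wiener} {c : Hardy} (hc : c ∈ kopRange u)
    (h : kop u c = 0) : c = 0 := by
  obtain ⟨f, rfl⟩ := hc
  rw [← inner_self_eq_zero (𝕜 := ℂ), inner_kop_comm, h, inner_zero_left]

theorem exists_eigenvector {u : Wiener} [FiniteDimensional ℂ (kopRange u)]
    {V : Hardy →ₗ[ℂ] Hardy} (hV : ∀ c, V c = 0 → V (kop u c) = 0)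
    (h : ∃ c ∈ kopRange u, c ≠ 0 ∧ V c = 0) :
    ∃ σ : ℝ, 0 < σ ∧ ∃ c, c ≠ 0 ∧ ksq u c = ((σ ^ 2 : ℝ) : ℂ) • c ∧ V c = 0 := by
  obtain ⟨c₀, hc₀R, hc₀, hc₀V⟩ := h
  set Z : Submodule ℂ Hardy := LinearMap.ker V ⊓ kopRange u
  have hZ : ∀ c ∈ Z, (ksq u : Hardy →ₗ[ℂ] Hardy) c ∈ Z := by
    rintro c ⟨h1, -⟩
    have e : (ksq u : Hardy →ₗ[ℂ] Hardy) c = kop u (kop u c) := ksq_apply u c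
    rw [e]
    exact ⟨hV _ (hV _ h1), ⟨_, rfl⟩⟩
  have : FiniteDimensional ℂ Z := Submodule.finiteDimensional_of_le inf_le_right
  have : Nontrivial Z :=
    ⟨⟨c₀, hc₀V, hc₀R⟩, 0, fun h => hc₀ (congrArg Subtype.val h)⟩
  obtain ⟨μ, hμ⟩ := Module.End.exists_eigenvalue ((ksq u : Hardy →ₗ[ℂ] Hardy).restrict hZ)
  obtain ⟨⟨c, hcV, hcR⟩, hc⟩ := hμ.exists_hasEigenvector
  have hc0 : c ≠ 0 := fun h => hc.2 (Subtype.ext h)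
  have hcμ : ksq u c = μ • c := congrArg Subtype.val hc.apply_eq_smul
  have hk : kop u c ≠ 0 := fun h => hc0 (eq_zero_of_mem_kopRange hcR h)
  have h1 := inner_ksq_self u c
  rw [hcμ, inner_smul_right, inner_self_eq_norm_sq_to_K] at h1
  have hn : (‖c‖ : ℂ) ≠ 0 := by exact_mod_cast (norm_pos_iff.2 hc0).ne'
  refine ⟨‖kop u c‖ / ‖c‖, div_pos (norm_pos_iff.2 hk) (norm_pos_iff.2 hc0), c, hc0, ?_, hcV⟩
  rw [hcμ]
  congr 1
  push_cast
  rw [div_pow, ← h1]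
  field_simp
  rfl

/-- The kernel of the weak limit of the transports meets trivially every eigenspace of `K_u²` on
which the isotropic vectors are orthogonal to `u` and `1`. -/
theorem eq_zero_of_weak_limit_eq_zero {l : Filter ℕ} [l.NeBot] {α Θ μ : ℝ} {u : Wiener}
    {v : ℕ → Wiener} {W : ℕ → Hardy →L[ℂ] Hardy} (hW : ∀ n, Transports α u (v n) (W n))
    (hv : ∀ (n J : ℕ), J * ‖(bshift 2 ^ J) (emb (v n))‖ ^ 2 ≤ Θ) {x : Hardy}
    (hx : ∀ k, Tendsto (fun n => v n k) l (𝓝 (x k))) {V : Hardy →ₗ[ℂ] Hardy}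
    (hV : ∀ c k, Tendsto (fun n => W n c k) l (𝓝 (V c k)))
    (hiso : ∀ c, ksq u c = (μ : ℂ) • c → ‖inner ℂ (emb u) c‖ ^ 2 = α * ‖c 0‖ ^ 2 →
      inner ℂ (emb u) c = 0 ∧ c 0 = 0)
    {c : Hardy} (hc : ksq u c = (μ : ℂ) • c) (hVc : V c = 0) : c = 0 := by
  have key : ∀ c, ksq u c = (μ : ℂ) • c → V c = 0 → inner ℂ (emb u) c = 0 ∧ c 0 = 0 := by
    intro c hc hVc
    refine hiso c hc (sub_eq_zero.1 ?_)
    have h1 : Tendsto (fun n => inner ℂ (emb (v n)) (W n c)) l (𝓝 (inner ℂ x (V c))) :=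
      tendsto_inner_of_tail hv (fun n => ((hW n).norm_map c).le)
        (fun k => by simpa only [emb_apply] using hx k) (hV c)
    have h2 := (h1.norm.pow 2).sub (((hV c 0).norm.pow 2).const_mul α)
    simp only [(hW _).conserved c μ hc, hVc, inner_zero_right] at h2
    simpa using tendsto_nhds_unique tendsto_const_nhds h2
  have step : ∀ c, ksq u c = (μ : ℂ) • c → V c = 0 →
      ksq u (bshift 2 c) = (μ : ℂ) • bshift 2 c ∧ V (bshift 2 c) = 0 := by
    intro c hc hVc
    obtain ⟨h1, h2⟩ := key c hc hVc
    refine ⟨by rw [ksq_bshift, h1, h2, hc, map_smul, zero_smul, zero_smul, add_zero, sub_zero], ?_⟩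
    ext k
    refine tendsto_nhds_unique (hV _ k) ((hV c (k + 1)).congr' (.of_forall fun n => ?_) |>.trans ?_)
    · rw [← ((hW n).orthogonal c μ hc h1 h2).2.2, bshift_apply]
    · rw [hVc]; exact le_rfl
  have all : ∀ k, ksq u ((bshift 2 ^ k) c) = (μ : ℂ) • (bshift 2 ^ k) c ∧
      V ((bshift 2 ^ k) c) = 0 := by
    intro k
    induction k with
    | zero => exact ⟨hc, hVc⟩
    | succ k ih => rw [pow_succ', mul_apply_eq_comp]; exact step _ ih.1 ih.2
  ext k
  have h := (key _ (all k).1 (all k).2).2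
  rwa [bshift_pow_apply_hardy, zero_add] at h

theorem hinner_coe (f g : Hardy) : hinner f g = inner ℂ g f := by
  refine ((hasSum_inner_hardy g f).congr_fun fun n => ?_).tsum_eq
  exact mul_comm _ _

theorem l2normSq_coe (f : Hardy) : l2normSq f = ‖f‖ ^ 2 := by
  rw [l2normSq]
  have h := lp.norm_rpow_eq_tsum (p := 2) (by simp) f
  simpa using h.symm

theorem coe_mem_Fspace {u : Wiener} {σ : ℝ} {h : Hardy} :
    (h : ℕ → ℂ) ∈ Fspace u σ ↔ ksq u h = ((σ ^ 2 : ℝ) : ℂ) • h := by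
  have h1 : ku2 u h = ksq u h := by rw [ku2, ← kop_coe, ← kop_coe, ksq_apply]
  rw [Fspace, Set.mem_ofPred_eq, h1]
  refine ⟨fun ⟨_, h⟩ => lp.ext ?_, fun h => ⟨lp.memℓp _, ?_⟩⟩
  · rw [h, lp.coeFn_smul, Complex.ofReal_pow]
  · rw [h, lp.coeFn_smul, Complex.ofReal_pow]

theorem coe_emb (u : Wiener) : (emb u : ℕ → ℂ) = u := funext (emb_apply u)

theorem coe_oneH : (oneH : ℕ → ℂ) = oneSeq := funext oneH_apply

theorem exists_eq_of_isOrthProj {u : Wiener} {σ : ℝ} {w : Hardy} {p : ℕ → ℂ}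
    (h : IsOrthProj (Fspace u σ) w p) : ∃ P : Hardy, (P : ℕ → ℂ) = p ∧
      ksq u P = ((σ ^ 2 : ℝ) : ℂ) • P ∧
      ∀ f, ksq u f = ((σ ^ 2 : ℝ) : ℂ) • f → inner ℂ P f = inner ℂ w f := by
  refine ⟨⟨p, h.1.1⟩, rfl, coe_mem_Fspace.1 h.1, fun f hf => ?_⟩
  have h1 := h.2 f (coe_mem_Fspace.2 hf)
  change hinner (⇑w - ⇑(⟨p, h.1.1⟩ : Hardy)) f = 0 at h1
  rw [← lp.coeFn_sub, hinner_coe, inner_sub_right, sub_eq_zero] at h1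
  rw [← inner_conj_symm, ← h1, inner_conj_symm]

theorem isotropic_orthogonal {α : ℝ} (hα : α ≠ 0) (u : Wiener) {σ : ℝ} (hσ : 0 < σ)
    (hno : σ ∈ SigmaK u → ∃ p q, IsOrthProj (Fspace u σ) u p ∧ IsOrthProj (Fspace u σ) oneSeq q ∧
      l2normSq p - α * l2normSq q ≠ 0)
    {c : Hardy} (hc : ksq u c = ((σ ^ 2 : ℝ) : ℂ) • c)
    (hiso : ‖inner ℂ (emb u) c‖ ^ 2 = α * ‖c 0‖ ^ 2) : inner ℂ (emb u) c = 0 ∧ c 0 = 0 := by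
  by_cases hmem : σ ∈ SigmaK u
  · obtain ⟨p, q, hp, hq, hpq⟩ := hno hmem
    have hp : IsOrthProj (Fspace u σ) (emb u) p := by rwa [coe_emb]
    have hq : IsOrthProj (Fspace u σ) oneH q := by rwa [coe_oneH]
    obtain ⟨P, rfl, hP, hP'⟩ := exists_eq_of_isOrthProj hp
    obtain ⟨Q, rfl, hQ, hQ'⟩ := exists_eq_of_isOrthProj hq
    rw [l2normSq_coe, l2normSq_coe] at hpq
    have h0 := apply_zero_eq_zero_of_isotropic u (by positivity) hc hP hQ hP'
      (fun f hf => (hQ' f hf).trans (inner_oneH_left f)) hpq hiso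
    refine ⟨?_, h0⟩
    rw [h0] at hiso
    simpa using hiso
  · have h0 : inner ℂ (emb u) c = 0 := by
      by_contra hne
      refine hmem ⟨hσ.le, c, coe_mem_Fspace.2 hc, fun h => hne ?_⟩
      rw [← coe_emb, hinner_coe] at h
      rw [← inner_conj_symm, h, map_zero]
    rw [h0] at hiso
    refine ⟨h0, ?_⟩
    simpa [hα] using hiso.symm

theorem h12inner_single (f : ℕ → ℂ) (k : ℕ) :
    h12inner f (Pi.single k 1) = ((((1 : ℝ) + (k : ℝ) ^ 2) ^ ((1 : ℝ) / 2) : ℝ) : ℂ) * f k := by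
  rw [h12inner, tsum_eq_single k fun n hn => by simp [hn]]
  simp

theorem memHs_single (s : ℝ) (k : ℕ) : MemHs s (Pi.single k 1) :=
  summable_of_ne_finset_zero (s := {k}) fun n hn => by
    simp [Finset.notMem_singleton.1 hn]

theorem memℓp_two_of_memHs {u : ℕ → ℂ} (hu : MemHs (1 / 2) u) : Memℓp u 2 := by
  refine memℓp_gen ?_
  simp only [ENNReal.toReal_ofNat, Real.rpow_ofNat]
  refine Summable.of_nonneg_of_le (fun n => by positivity) (fun n => ?_) hu
  exact le_mul_of_one_le_left (by positivity)
    (Real.one_le_rpow (by nlinarith [sq_nonneg (n : ℝ)]) (by norm_num))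

theorem tendsto_coeff_of_weak {u : ℕ → ℕ → ℂ} {x : ℕ → ℂ}
    (h : ∀ v, MemHs (1 / 2) v →
      Tendsto (fun j => h12inner (u j) v) atTop (𝓝 (h12inner x v))) (k : ℕ) :
    Tendsto (fun j => u j k) atTop (𝓝 (x k)) := by
  have h1 := h _ (memHs_single _ k)
  simp only [h12inner_single] at h1
  have hne : ((((1 : ℝ) + (k : ℝ) ^ 2) ^ ((1 : ℝ) / 2) : ℝ) : ℂ) ≠ 0 := by
    exact_mod_cast (Real.rpow_pos_of_pos (by positivity) _).ne'
  have h2 := h1.const_mul ((((1 : ℝ) + (k : ℝ) ^ 2) ^ ((1 : ℝ) / 2) : ℝ) : ℂ)⁻¹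
  simpa only [inv_mul_cancel_left₀ hne] using h2

end Szego

open Szego

/-- Necessary condition for norm explosion: if a weak limit `u^∞` of
the solution along times `t_n → ∞` satisfies `rank K_{u^∞} < rank K_{u₀}`, then
`ℓ_k(u₀) = ‖u'_k‖² − α‖v'_k‖² = 0` for some `σ_k ∈ Σ_K(u₀)`. -/
theorem necessary_condition_norm_explosion (α : ℝ) (hα : α ≠ 0) (N : ℕ) (hN : 1 ≤ N)
    (u₀ : ℕ → ℂ) (hu₀ : InLN N u₀) (hu₀s : ∀ s : ℝ, MemHs s u₀)
    (u : ℝ → ℕ → ℂ) (hu0 : u 0 = u₀) (hreg : ∀ s : ℝ, SmoothHsCurve s u)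
    (hsol : SolvesSzego α u)
    (tn : ℕ → ℝ) (htn : Filter.Tendsto tn Filter.atTop Filter.atTop)
    (uinf : ℕ → ℂ) (huinf : MemHs (1/2) uinf)
    (hweak : ∀ v : ℕ → ℂ, MemHs (1/2) v →
      Filter.Tendsto (fun j => h12inner (u (tn j)) v) Filter.atTop (𝓝 (h12inner uinf v)))
    (hrank : kuRank uinf < kuRank u₀) :
    ∃ σ ∈ SigmaK u₀, ∀ p q : ℕ → ℂ,
      IsOrthProj (Fspace u₀ σ) u₀ p → IsOrthProj (Fspace u₀ σ) oneSeq q →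
      l2normSq p - α * l2normSq q = 0 := by
  have hs : ∀ t, Summable fun n : ℕ => ((n : ℝ) + 1) * ‖u t n‖ := fun t =>
    summable_weighted_of_memHs ((hreg 2).1 t)
  set U : ℝ → Wiener := fun t => ⟨u t, memℓp_one_of_summable (hs t)⟩
  have hUc : ∀ t, (U t : ℕ → ℂ) = u t := fun t => rfl
  have hw : ∀ t, Summable fun m : ℕ => ((m : ℝ) + 1) * ‖U t (m + 1)‖ := fun t =>
    Summable.of_nonneg_of_le (fun m => by positivity)
      (fun m => by rw [hUc]; push_cast; gcongr; linarith) ((summable_nat_add_iff 1).2 (hs t))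
  have hU : ∀ n t, HasDerivAt (fun τ => U τ n) (field α (U t) n) t := fun n t => by
    rw [field_apply]; exact hsol n t
  subst hu0
  rw [← hUc] at hu₀ hrank ⊢
  set x : Hardy := ⟨uinf, memℓp_two_of_memHs huinf⟩
  have hx := tendsto_coeff_of_weak hweak
  choose W hW using fun n => exists_transports_of_summable hU hw 0 (tn n)
  obtain ⟨l, hl⟩ := Ultrafilter.exists_le (atTop : Filter ℕ)
  obtain ⟨V, hV⟩ := exists_weak_limit l fun n c => ((hW n).norm_map c).le
  have hv : ∀ (n J : ℕ), J * ‖(bshift 2 ^ J) (emb (U (tn n)))‖ ^ 2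
      ≤ max 1 (‖U 0‖ ^ 2) * wnorm (U 0) := fun n J =>
    let ⟨_, h⟩ := exists_transports_of_summable hU hw (tn n) 0
    h.tail_le (hw 0) J
  have hx' : ∀ k, Tendsto (fun n => U (tn n) k) l (𝓝 (x k)) := fun k => (hx k).mono_left hl
  have hK := khankel_weak_limit hW hv hx' hV
  have : FiniteDimensional ℂ (kopRange (U 0)) := by
    refine Module.rank_lt_aleph0_iff.1 ?_
    rw [← kuRank_eq, hu₀.2]
    exact Cardinal.natCast_lt_aleph0
  obtain ⟨σ, hσ, c, hc0, hc, hVc⟩ := exists_eigenvector (u := U 0) (V := V)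
    (fun c hc => lp.ext (by
      rw [← hK c, hc]
      funext k
      rw [khankel_eq_inner, inner_zero_left]; rfl))
    (exists_ker_of_kuRank_lt hK hrank)
  by_contra! hno
  exact hc0 (eq_zero_of_weak_limit_eq_zero hW hv hx' hV
    (fun c hc hiso => isotropic_orthogonal hα (U 0) hσ (hno σ) hc hiso) hc hVc)

end
end

section
/- Let α ∈ ℝ, s > 1/2, and let χ be a finite Blaschke product that does not depend on time. For u ∈ C^∞(ℝ, H^s₊(S¹)) define ũ(t) ∈ H^s₊ by ũ(t,z) := u(t, zχ(z)), i.e. ũ(t,z) = Σ_{n≥0} û(t,n)·(zχ(z))^n. Then u solves the α-Szegő equation i∂ₜu = Π(|u|²u) + α(u|1) if and only if ũ solves the α-Szegő equation. -/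
open Complex Filter
open scoped ComplexConjugate Topology ENNReal

noncomputable section

/-- Cauchy product of two Taylor-coefficient sequences (product of holomorphic functions). -/
def mulSeq (a b : ℕ → ℂ) : ℕ → ℂ := fun n => ∑ k ∈ Finset.range (n + 1), a k * b (n - k)

/-- Taylor coefficients of the n-th power of a holomorphic function. -/
def powSeq (a : ℕ → ℂ) : ℕ → ℕ → ℂ := fun n => (mulSeq a)^[n] oneSeq

/-- Taylor coefficients of z·χ(z), given those of χ. -/
def shiftSeq (χ : ℕ → ℂ) : ℕ → ℂ := fun m => if m = 0 then 0 else χ (m - 1)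

/-- Taylor coefficients of the substitution ũ(z) = u(zχ(z)) = Σₙ û(n) (zχ(z))ⁿ. -/
def substSeq (χ : ℕ → ℂ) (u : ℕ → ℂ) : ℕ → ℂ :=
  fun m => ∑' n : ℕ, u n * powSeq (shiftSeq χ) n m

/-- `χ` is the coefficient sequence of a finite Blaschke product
`e^{-iψ} P(z)/D(z)`, where `P` is monic with all roots in the open unit disc and
`D(z) = z^k conj(P)(1/z)` is the normalized denominator. -/
def IsBlaschkeCoeff (χ : ℕ → ℂ) : Prop :=
  ∃ (k : ℕ) (ψ : ℝ) (P : Polynomial ℂ), P.Monic ∧ P.natDegree = k ∧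
    (∀ r ∈ P.roots, ‖r‖ < 1) ∧
    ∀ z : ℂ, ‖z‖ < 1 →
      ∑' n : ℕ, χ n * z ^ n =
        Complex.exp (-(ψ : ℂ) * Complex.I) * P.eval z /
          ((P.map (starRingEnd ℂ)).reverse.eval z)


/-- The power series with the Fourier coefficients of an element of the Hardy space. -/
def toSeries : Hardy →ₗ[ℂ] PowerSeries ℂ where
  toFun f := PowerSeries.mk fun n => f n
  map_add' f g := by ext n; simp only [PowerSeries.coeff_mk, map_add]; rfl
  map_smul' c f := by ext n; simp only [PowerSeries.coeff_mk, map_smul]; rfl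

@[simp]
theorem coeff_toSeries (n : ℕ) (f : Hardy) : PowerSeries.coeff n (toSeries f) = f n :=
  PowerSeries.coeff_mk n _

/-- Multiplication by the power series `a` acts isometrically on the Hardy space. -/
def IsometricMul (a : PowerSeries ℂ) : Prop :=
  ∃ M : Hardy →ₗᵢ[ℂ] Hardy, ∀ f : Hardy, toSeries (M f) = a * toSeries f

/-- `a` acts isometrically by multiplication and `z a'(z)` lies in the Hardy space. -/
def SmoothInner (a : PowerSeries ℂ) : Prop :=
  IsometricMul a ∧ ∃ g : Hardy, toSeries g = PowerSeries.X * PowerSeries.derivative ℂ a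

section Inner

open PowerSeries

theorem toSeries_oneH : toSeries oneH = (1 : PowerSeries ℂ) := by
  ext n
  simp [oneH, lp.single_apply, Pi.single_apply, coeff_one]

theorem hardy_ext {f g : Hardy} (h : (toSeries f : PowerSeries ℂ) = toSeries g) : f = g := by
  ext n
  simpa using congrArg (coeff n) h

theorem hardy_hasSum_norm_sq (f : Hardy) : HasSum (fun n => ‖f n‖ ^ 2) (‖f‖ ^ 2) := by
  have h := lp.hasSum_norm (p := 2) (by norm_num) f
  simpa using h

theorem memLp_two_of_summable {f : ℕ → ℂ} (h : Summable fun n => ‖f n‖ ^ 2) :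
    Memℓp f 2 := by
  rw [memℓp_gen_iff (by norm_num)]
  simpa using h

theorem IsometricMul.of_exists {a : PowerSeries ℂ}
    (h : ∀ f : Hardy, ∃ g : Hardy, toSeries g = a * toSeries f ∧ ‖g‖ = ‖f‖) : IsometricMul a := by
  choose M hM hn using h
  refine ⟨⟨⟨⟨M, fun f g => ?_⟩, fun c f => ?_⟩, hn⟩, hM⟩
  · apply hardy_ext
    rw [hM, map_add, map_add, hM, hM, mul_add]
  · apply hardy_ext
    simp only [RingHom.id_apply]
    rw [hM, map_smul, map_smul, hM, smul_eq_C_mul, smul_eq_C_mul]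
    ring

theorem IsometricMul.mul {a b : PowerSeries ℂ} (ha : IsometricMul a) (hb : IsometricMul b) :
    IsometricMul (a * b) := by
  obtain ⟨M, hM⟩ := ha
  obtain ⟨N, hN⟩ := hb
  refine ⟨M.comp N, fun f => ?_⟩
  rw [LinearIsometry.coe_comp, Function.comp_apply, hM, hN, mul_assoc]

theorem IsometricMul.X : IsometricMul (PowerSeries.X : PowerSeries ℂ) := by
  refine .of_exists fun f => ?_
  have hs : HasSum (fun n => ‖(fun n : ℕ => if n = 0 then 0 else f (n - 1) : ℕ → ℂ) n‖ ^ 2)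
      (‖f‖ ^ 2) := by
    rw [← hasSum_nat_add_iff' 1]
    simpa using hardy_hasSum_norm_sq f
  refine ⟨⟨_, memLp_two_of_summable hs.summable⟩, ?_, ?_⟩
  · ext n
    cases n with
    | zero => simp
    | succ n => simp [coeff_succ_X_mul]
  · have := (hardy_hasSum_norm_sq ⟨_, memLp_two_of_summable hs.summable⟩).unique hs
    exact (sq_eq_sq₀ (norm_nonneg _) (norm_nonneg _)).1 this

theorem IsometricMul.C {c : ℂ} (hc : ‖c‖ = 1) : IsometricMul (PowerSeries.C c : PowerSeries ℂ) :=
  .of_exists fun f => ⟨c • f, by rw [map_smul, smul_eq_C_mul], by rw [norm_smul, hc, one_mul]⟩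

theorem exists_one_sub_mul_eq {c : ℂ} (hc : ‖c‖ < 1) (h : Hardy) :
    ∃ g : Hardy, (1 - PowerSeries.C c * PowerSeries.X) * toSeries g = toSeries h := by
  obtain ⟨S, hS⟩ := IsometricMul.X
  have hn : ‖c • S.toContinuousLinearMap‖ < 1 := by
    refine lt_of_le_of_lt ?_ hc
    rw [norm_smul]
    exact mul_le_of_le_one_right (norm_nonneg _) S.norm_toContinuousLinearMap_le
  obtain ⟨T, hT⟩ := isUnit_one_sub_of_norm_lt_one hn
  refine ⟨(↑T⁻¹ : Hardy →L[ℂ] Hardy) h, ?_⟩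
  set g := (↑T⁻¹ : Hardy →L[ℂ] Hardy) h
  have h1 : (T : Hardy →L[ℂ] Hardy) g = h := by
    have := congrArg (fun A : Hardy →L[ℂ] Hardy => A h) T.mul_inv
    exact this
  have h2 : g - c • S g = h := by
    rw [hT] at h1
    simpa using h1
  rw [← h2, map_sub, map_smul, smul_eq_C_mul, hS]
  ring

theorem SmoothInner.mul {a b : PowerSeries ℂ} (ha : SmoothInner a) (hb : SmoothInner b) :
    SmoothInner (a * b) := by
  refine ⟨ha.1.mul hb.1, ?_⟩
  obtain ⟨⟨M, hM⟩, f, hf⟩ := ha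
  obtain ⟨⟨N, hN⟩, g, hg⟩ := hb
  refine ⟨M g + N f, ?_⟩
  rw [map_add, hM, hN, hf, hg, Derivation.leibniz]
  simp only [smul_eq_mul]
  ring

theorem SmoothInner.X : SmoothInner (PowerSeries.X : PowerSeries ℂ) := by
  refine ⟨.X, ?_⟩
  obtain ⟨S, hS⟩ := IsometricMul.X
  refine ⟨S oneH, ?_⟩
  rw [hS, toSeries_oneH]
  simp

theorem SmoothInner.C {c : ℂ} (hc : ‖c‖ = 1) : SmoothInner (PowerSeries.C c : PowerSeries ℂ) :=
  ⟨.C hc, 0, by simp⟩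

theorem norm_sub_smul_eq {S : Hardy →ₗᵢ[ℂ] Hardy} (a : ℂ) (g : Hardy) :
    ‖S g - a • g‖ = ‖g - conj a • S g‖ := by
  have h : a * inner ℂ (S g) g = conj (conj a * inner ℂ g (S g)) := by
    rw [map_mul, RCLike.conj_conj, inner_conj_symm]
  rw [← sq_eq_sq₀ (norm_nonneg _) (norm_nonneg _), @norm_sub_sq ℂ, @norm_sub_sq ℂ,
    norm_smul, norm_smul, S.norm_map, RCLike.norm_conj, inner_smul_right, inner_smul_right,
    h, RCLike.conj_re]

theorem exists_smoothInner_factor {a : ℂ} (ha : ‖a‖ < 1) :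
    ∃ b : PowerSeries ℂ, SmoothInner b ∧
      (1 - PowerSeries.C (conj a) * PowerSeries.X) * b = PowerSeries.X - PowerSeries.C a := by
  have ha' : ‖conj a‖ < 1 := by rwa [RCLike.norm_conj]
  set D : PowerSeries ℂ := 1 - PowerSeries.C (conj a) * PowerSeries.X with hD
  have hD0 : constantCoeff D ≠ 0 := by simp [hD]
  have hD1 : D ≠ 0 := fun h => hD0 (by simp [h])
  set b : PowerSeries ℂ := (PowerSeries.X - PowerSeries.C a) * D⁻¹ with hb
  have hDb : D * b = PowerSeries.X - PowerSeries.C a := by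
    rw [hb, mul_left_comm, PowerSeries.mul_inv_cancel _ hD0, mul_one]
  obtain ⟨S, hS⟩ := IsometricMul.X
  have hiso : IsometricMul b := by
    refine .of_exists fun h => ?_
    obtain ⟨g, hg⟩ := exists_one_sub_mul_eq ha' h
    refine ⟨S g - a • g, ?_, ?_⟩
    · apply mul_left_cancel₀ hD1
      rw [← mul_assoc, hDb, ← hg, map_sub, map_smul, smul_eq_C_mul, hS]
      ring
    · rw [norm_sub_smul_eq]
      congr 1
      apply hardy_ext
      rw [← hg, map_sub, map_smul, smul_eq_C_mul, hS]
      ring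
  refine ⟨b, ⟨hiso, ?_⟩, hDb⟩
  obtain ⟨B, hB⟩ := hiso
  obtain ⟨g, hg⟩ := exists_one_sub_mul_eq ha' (oneH + conj a • B oneH)
  refine ⟨S g, ?_⟩
  rw [hS]
  congr 1
  apply mul_left_cancel₀ hD1
  rw [hg, map_add, map_smul, smul_eq_C_mul, hB, toSeries_oneH]
  have h1 := congrArg (PowerSeries.derivative ℂ) hDb
  rw [Derivation.leibniz] at h1
  simp only [hD, map_sub, Derivation.leibniz, smul_eq_mul, derivative_X, derivative_C,
    Derivation.map_one_eq_zero] at h1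
  rw [← hD] at h1
  linear_combination -h1

end Inner

section Substitution

open PowerSeries

theorem hardy_inner_eq_tsum (f g : Hardy) : inner ℂ f g = ∑' n, g n * conj (f n) :=
  lp.inner_eq_tsum f g

theorem inner_oneH_left (f : Hardy) : inner ℂ oneH f = f 0 := by
  rw [oneH, lp.inner_single_left]
  simp

theorem IsometricMul.one : IsometricMul 1 :=
  ⟨LinearIsometry.id, fun f => by simp⟩

theorem IsometricMul.pow {a : PowerSeries ℂ} (ha : IsometricMul a) (n : ℕ) :
    IsometricMul (a ^ n) := by
  induction n with
  | zero => rw [pow_zero]; exact .one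
  | succ n ih => rw [pow_succ]; exact ih.mul ha

theorem IsometricMul.inner_eq {a : PowerSeries ℂ} (ha : IsometricMul a) {f g x y : Hardy}
    (hx : toSeries x = a * toSeries f) (hy : toSeries y = a * toSeries g) :
    inner ℂ x y = inner ℂ f g := by
  obtain ⟨M, hM⟩ := ha
  rw [hardy_ext (hx.trans (hM f).symm), hardy_ext (hy.trans (hM g).symm), M.inner_map_map]

theorem IsometricMul.exists_eq_pow {a : PowerSeries ℂ} (ha : IsometricMul a) :
    ∃ θ : ℕ → Hardy, ∀ n, toSeries (θ n) = a ^ n := by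
  choose M hM using fun n => ha.pow n
  exact ⟨fun n => M n oneH, fun n => by rw [hM, toSeries_oneH, mul_one]⟩

theorem orthonormal_of_toSeries_eq_pow {a : PowerSeries ℂ} (ha : IsometricMul a)
    (ha0 : constantCoeff a = 0) {θ : ℕ → Hardy} (hθ : ∀ n, toSeries (θ n) = a ^ n) :
    Orthonormal ℂ θ := by
  have key : ∀ m j, inner ℂ (θ m) (θ (m + j)) = if j = 0 then 1 else 0 := by
    intro m j
    rw [(ha.pow m).inner_eq (f := oneH) (g := θ j) (by rw [hθ, toSeries_oneH, mul_one])
      (by rw [hθ, hθ, pow_add]), inner_oneH_left, ← coeff_toSeries, hθ]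
    simp [ha0, zero_pow_eq]
  rw [orthonormal_iff_ite]
  intro i j
  rcases le_total i j with h | h
  · obtain ⟨k, rfl⟩ := Nat.exists_eq_add_of_le h
    simp [key]
  · obtain ⟨k, rfl⟩ := Nat.exists_eq_add_of_le h
    rw [← inner_conj_symm, key]
    split_ifs <;> simp_all

theorem coeff_pow_eq_zero_of_lt {a : PowerSeries ℂ} (ha0 : constantCoeff a = 0) {k n : ℕ}
    (h : k < n) : coeff k (a ^ n) = 0 :=
  coeff_of_lt_order _ (lt_of_lt_of_le (by exact_mod_cast h)
    (le_order_pow_of_constantCoeff_eq_zero n ha0))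

theorem coeff_subst_eq_tsum {a : PowerSeries ℂ} (ha0 : constantCoeff a = 0)
    (f : PowerSeries ℂ) (k : ℕ) :
    coeff k (f.subst a) = ∑' n, coeff n f * coeff k (a ^ n) := by
  rw [coeff_subst' (.of_constantCoeff_zero' ha0), tsum_eq_finsum]
  · rfl
  · refine (Finset.range (k + 1)).finite_toSet.subset fun n hn => ?_
    contrapose! hn
    have : k < n := by simpa using hn
    simp [coeff_pow_eq_zero_of_lt ha0 this]

theorem coeff_subst_eq_sum {a : PowerSeries ℂ} (ha0 : constantCoeff a = 0)
    (f : PowerSeries ℂ) {k N : ℕ} (hk : k < N) :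
    coeff k (f.subst a) = ∑ n ∈ Finset.range N, coeff n f * coeff k (a ^ n) := by
  rw [coeff_subst_eq_tsum ha0, tsum_eq_sum]
  intro n hn
  have : k < n := by simp at hn; omega
  simp [coeff_pow_eq_zero_of_lt ha0 this]

theorem exists_subst_isometry {a : PowerSeries ℂ} (ha : IsometricMul a)
    (ha0 : constantCoeff a = 0) :
    ∃ V : Hardy →ₗᵢ[ℂ] Hardy, ∀ f, toSeries (V f) = (toSeries f).subst a := by
  obtain ⟨θ, hθ⟩ := ha.exists_eq_pow
  have ho := (orthonormal_of_toSeries_eq_pow ha ha0 hθ).orthogonalFamily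
  refine ⟨ho.linearIsometry, fun f => ?_⟩
  ext k
  have h := (ho.hasSum_linearIsometry f).mapL (lp.evalCLM ℂ (fun _ : ℕ => ℂ) 2 k)
  rw [coeff_subst_eq_tsum ha0, coeff_toSeries]
  refine (h.tsum_eq.symm.trans (tsum_congr fun n => ?_))
  rw [coeff_toSeries, ← hθ, coeff_toSeries]
  rfl

theorem hankel_eq_inner {k : ℕ} {w g x : Hardy} (hx : toSeries x = X ^ k * toSeries g) :
    hankel w g k = inner ℂ x w := by
  have h0 : ∀ n, x n = if k ≤ n then g (n - k) else 0 := by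
    intro n
    rw [← coeff_toSeries, hx, coeff_X_pow_mul', coeff_toSeries]
  have hs : Summable fun n => w n * conj (x n) := lp.summable_inner x w
  rw [hardy_inner_eq_tsum, ← hs.sum_add_tsum_nat_add k, Finset.sum_eq_zero, zero_add, hankel]
  · refine tsum_congr fun l => ?_
    rw [h0, if_pos (by omega), Nat.add_sub_cancel, add_comm]
  · intro n hn
    rw [h0, if_neg (by simpa using hn)]
    simp

theorem hankel_subst_eq {a : PowerSeries ℂ} (ha : IsometricMul a)
    (ha0 : constantCoeff a = 0) {V : Hardy →ₗᵢ[ℂ] Hardy}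
    (hV : ∀ f, toSeries (V f) = (toSeries f).subst a) (w g : Hardy) (k : ℕ) :
    hankel (V w) (V g) k = coeff k ((PowerSeries.mk (hankel w g)).subst a) := by
  choose S hS using fun n => IsometricMul.X.pow n
  rw [hankel_eq_inner (hS k (V g)), coeff_subst_eq_sum ha0 _ k.lt_succ_self]
  simp_rw [coeff_mk, fun n => hankel_eq_inner (w := w) (hS n g)]
  obtain ⟨e, he⟩ := IsometricMul.X.exists_eq_pow
  obtain ⟨θ, hθ⟩ := ha.exists_eq_pow
  have heo := orthonormal_of_toSeries_eq_pow .X constantCoeff_X he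
  have hVe : ∀ n, V (e n) = θ n := fun n => hardy_ext <| by
    rw [hV, he, subst_pow (.of_constantCoeff_zero' ha0), subst_X (.of_constantCoeff_zero' ha0), hθ]
  have hSe : ∀ n m, S n (e m) = e (n + m) := fun n m => hardy_ext <| by
    rw [hS, he, he, pow_add]
  have hsingle : ∀ n, ∀ c : ℂ, lp.single 2 n c = c • e n := fun n c => hardy_ext <| by
    ext m
    rw [map_smul, smul_eq_C_mul, he, coeff_toSeries, coeff_C_mul, coeff_X_pow]
    simp [lp.single_apply, Pi.single_apply]
  have hbase : ∀ m n, inner ℂ (S k (θ m)) (θ n) =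
      ∑ i ∈ Finset.range (k + 1), inner ℂ (e (i + m)) (e n) * coeff k (a ^ i) := by
    intro m n
    simp_rw [orthonormal_iff_ite.1 heo]
    rcases le_or_gt m n with h | h
    · obtain ⟨j, rfl⟩ := Nat.exists_eq_add_of_le h
      rw [(ha.pow m).inner_eq (f := S k oneH) (g := θ j)
        (by rw [hS, hS, hθ, toSeries_oneH]; ring) (by rw [hθ, hθ, pow_add]),
        ← hankel_eq_inner (hS k oneH), hankel, tsum_eq_single 0]
      · simp_rw [fun i => show (i + m = m + j) = (i = j) by simp [add_comm]]
        have : coeff k (a ^ j) = θ j k := by rw [← coeff_toSeries, hθ]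
        simp only [ite_mul, one_mul, zero_mul, Finset.sum_ite_eq', Finset.mem_range]
        split_ifs with hj
        · simp [this, oneH]
        · rw [add_zero, ← this, coeff_pow_eq_zero_of_lt ha0 (by omega)]; simp
      · intro l hl
        simp [oneH, lp.single_apply, hl]
    · obtain ⟨j, rfl⟩ := Nat.exists_eq_add_of_lt h
      rw [(ha.pow n).inner_eq (f := S k (θ (j + 1))) (g := oneH)
        (by rw [hS, hS, hθ, hθ]; ring) (by rw [hθ, toSeries_oneH, mul_one]),
        ← inner_conj_symm, inner_oneH_left, ← coeff_toSeries, hS, hθ, Finset.sum_eq_zero]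
      · simp [ha0]
      · intro i _
        rw [if_neg (by omega), zero_mul]
  have hright : ∀ n, inner ℂ (S k (V g)) (θ n) =
      ∑ i ∈ Finset.range (k + 1), inner ℂ (S i g) (e n) * coeff k (a ^ i) := by
    intro n
    have : (innerSL ℂ (θ n)).comp ((S k).comp V).toContinuousLinearMap =
        ∑ i ∈ Finset.range (k + 1),
          conj (coeff k (a ^ i)) • (innerSL ℂ (e n)).comp (S i).toContinuousLinearMap := by
      refine lp.ext_continuousLinearMap (by norm_num) fun m => ?_
      ext
      have := congrArg conj (hbase m n)
      rw [map_sum] at this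
      simpa [hsingle, hVe, hSe, _root_.sum_apply, mul_comm] using this
    have := congrArg (fun A : Hardy →L[ℂ] ℂ => conj (A g)) this
    simpa [_root_.sum_apply, mul_comm] using this
  have : (innerSL ℂ (S k (V g))).comp V.toContinuousLinearMap =
      ∑ i ∈ Finset.range (k + 1), coeff k (a ^ i) • innerSL ℂ (S i g) := by
    refine lp.ext_continuousLinearMap (by norm_num) fun n => ?_
    ext
    simpa [hsingle, hVe, _root_.sum_apply, mul_comm] using hright n
  have := congrArg (fun A : Hardy →L[ℂ] ℂ => A w) this
  simpa [_root_.sum_apply, mul_comm] using this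

end Substitution

section Dirichlet

open PowerSeries

theorem SmoothInner.pow {a : PowerSeries ℂ} (ha : SmoothInner a) (n : ℕ) :
    SmoothInner (a ^ n) := by
  induction n with
  | zero => rw [pow_zero, ← map_one PowerSeries.C]; exact .C norm_one
  | succ n ih => rw [pow_succ]; exact ih.mul ha

theorem apply_of_toSeries_eq_X_mul_derivative {f g : Hardy}
    (h : toSeries g = X * PowerSeries.derivative ℂ (toSeries f)) (k : ℕ) : g k = k * f k := by
  rw [← coeff_toSeries, h, ← coeff_toSeries]
  cases k with
  | zero => simp
  | succ k => rw [coeff_succ_X_mul, coeff_derivative, mul_comm]; push_cast; rfl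

theorem inner_X_mul_derivative_comm {f g f' g' : Hardy}
    (hf : toSeries f' = X * PowerSeries.derivative ℂ (toSeries f))
    (hg : toSeries g' = X * PowerSeries.derivative ℂ (toSeries g)) :
    inner ℂ f g' = conj (inner ℂ g f') := by
  rw [inner_conj_symm, hardy_inner_eq_tsum, hardy_inner_eq_tsum]
  refine tsum_congr fun k => ?_
  rw [apply_of_toSeries_eq_X_mul_derivative hf, apply_of_toSeries_eq_X_mul_derivative hg]
  simp only [map_mul, map_natCast]
  ring

theorem inner_pow_X_mul_derivative_pow {a : PowerSeries ℂ} (ha : IsometricMul a)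
    {θ δ : ℕ → Hardy} (hθ : ∀ n, toSeries (θ n) = a ^ n)
    (hδ : ∀ n, toSeries (δ n) = X * PowerSeries.derivative ℂ (a ^ n)) (m n : ℕ) :
    inner ℂ (θ m) (δ n) = if m = n then n * inner ℂ (θ 1) (δ 1) else 0 := by
  have hlt : ∀ m j, inner ℂ (θ m) (δ (m + j + 1)) = 0 := by
    intro m j
    obtain ⟨M, hM⟩ := ha.pow j
    rw [(ha.pow m).inner_eq (f := oneH) (g := ((m + j + 1 : ℕ) : ℂ) • M (δ 1))
      (by rw [hθ, toSeries_oneH, mul_one]), inner_oneH_left, ← coeff_toSeries, map_smul,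
      hM, hδ]
    · simp
    · rw [map_smul, hM, hδ, hδ, Derivation.leibniz_pow, pow_one, smul_eq_C_mul]
      simp [pow_add]
      ring
  rcases lt_trichotomy m n with h | rfl | h
  · obtain ⟨j, rfl⟩ := Nat.exists_eq_add_of_lt h
    rw [hlt, if_neg (by omega)]
  · rw [if_pos rfl]
    cases m with
    | zero =>
      have : δ 0 = 0 := hardy_ext (by rw [hδ]; simp)
      simp [this]
    | succ m =>
      rw [(ha.pow m).inner_eq (f := θ 1) (g := ((m + 1 : ℕ) : ℂ) • δ 1)
        (by rw [hθ, hθ, pow_succ, pow_one]), inner_smul_right]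
      rw [map_smul, hδ, hδ, Derivation.leibniz_pow, pow_one, smul_eq_C_mul]
      simp
      ring
  · rw [inner_X_mul_derivative_comm (f' := δ m) (g := θ n) (by rw [hδ, hθ]) (by rw [hδ, hθ]),
      if_neg h.ne']
    obtain ⟨j, rfl⟩ := Nat.exists_eq_add_of_lt h
    rw [hlt, map_zero]

theorem summable_coeff_subst {a : PowerSeries ℂ} (ha : SmoothInner a)
    (ha0 : constantCoeff a = 0) {u : ℕ → ℂ} (hu : Summable fun n : ℕ => (n : ℝ) * ‖u n‖ ^ 2) :
    Summable fun n : ℕ => (n : ℝ) * ‖coeff n ((PowerSeries.mk u).subst a)‖ ^ 2 := by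
  obtain ⟨θ, hθ⟩ := ha.1.exists_eq_pow
  choose δ hδ using fun n => (ha.pow n).2
  have hθδ := inner_pow_X_mul_derivative_pow ha.1 hθ hδ
  generalize inner ℂ (θ 1) (δ 1) = d at hθδ
  refine summable_of_sum_range_le (c := ‖d‖ * ∑' n : ℕ, (n : ℝ) * ‖u n‖ ^ 2)
    (fun n => by positivity) fun N => ?_
  set f : Hardy := ∑ n ∈ Finset.range N, u n • θ n with hf
  set g : Hardy := ∑ n ∈ Finset.range N, u n • δ n with hg
  have hfg : toSeries g = X * PowerSeries.derivative ℂ (toSeries f) := by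
    simp only [hf, hg, map_sum, map_smul, Finset.mul_sum, hθ, hδ,
      Derivation.map_smul, mul_smul_comm]
  have hcoeff : ∀ k ∈ Finset.range N, coeff k ((PowerSeries.mk u).subst a) = f k := by
    intro k hk
    rw [coeff_subst_eq_sum ha0 _ (Finset.mem_range.1 hk), ← coeff_toSeries]
    simp only [hf, map_sum, map_smul, hθ, coeff_mk, smul_eq_mul]
  have hinner : inner ℂ f g = d * ((∑ n ∈ Finset.range N, (n : ℝ) * ‖u n‖ ^ 2 : ℝ) : ℂ) := by
    simp only [hf, hg, sum_inner, inner_sum, inner_smul_left, inner_smul_right,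
      hθδ, mul_ite, mul_zero]
    push_cast
    rw [Finset.mul_sum]
    refine Finset.sum_congr rfl fun n hn => ?_
    rw [Finset.sum_ite_eq', if_pos hn, ← Complex.mul_conj']
    ring
  have hsum : HasSum (fun k : ℕ => (k : ℝ) * ‖f k‖ ^ 2) (inner ℂ f g).re := by
    have h := Complex.hasSum_re (lp.hasSum_inner f g)
    convert h using 2 with k
    rw [apply_of_toSeries_eq_X_mul_derivative hfg, RCLike.inner_apply, mul_assoc,
      Complex.mul_conj']
    norm_cast
  calc ∑ k ∈ Finset.range N, (k : ℝ) * ‖coeff k ((PowerSeries.mk u).subst a)‖ ^ 2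
      = ∑ k ∈ Finset.range N, (k : ℝ) * ‖f k‖ ^ 2 :=
        Finset.sum_congr rfl fun k hk => by rw [hcoeff k hk]
    _ ≤ (inner ℂ f g).re := sum_le_hasSum _ (fun k _ => by positivity) hsum
    _ ≤ ‖inner ℂ f g‖ := Complex.re_le_norm _
    _ = ‖d‖ * ∑ n ∈ Finset.range N, (n : ℝ) * ‖u n‖ ^ 2 := by
        rw [hinner, norm_mul, Complex.norm_real, Real.norm_of_nonneg
          (Finset.sum_nonneg fun k _ => by positivity)]
    _ ≤ ‖d‖ * ∑' n : ℕ, (n : ℝ) * ‖u n‖ ^ 2 := by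
        gcongr
        exact hu.sum_le_tsum _ fun k _ => by positivity

end Dirichlet

section Cubic

open Finset

theorem summable_sq_sum_antidiagonal {a : ℕ → ℝ}
    (ha : Summable fun n : ℕ => (n + 1 : ℝ) * a n ^ 2) :
    Summable fun n => (∑ p ∈ antidiagonal n, a p.1 * a p.2) ^ 2 := by
  set b : ℕ → ℝ := fun n => (n + 1 : ℝ) * a n ^ 2 with hb
  have hb0 : 0 ≤ b := fun n => by simp only [hb, Pi.zero_apply]; positivity
  have h : Summable fun n => ∑ p ∈ antidiagonal n, b p.1 * b p.2 :=
    summable_sum_mul_antidiagonal_of_summable_mul (ha.mul_of_nonneg ha hb0 hb0)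
  refine h.of_nonneg_of_le (fun n => sq_nonneg _) fun n => ?_
  refine sq_sum_le_card_mul_sum_sq.trans ?_
  rw [Nat.card_antidiagonal, mul_sum]
  refine sum_le_sum fun p hp => ?_
  rw [HasAntidiagonal.mem_antidiagonal] at hp
  have : ((n + 1 : ℕ) : ℝ) ≤ (p.1 + 1) * (p.2 + 1) := by
    rw [← hp]
    push_cast
    nlinarith [mul_nonneg (Nat.cast_nonneg (α := ℝ) p.1) (Nat.cast_nonneg (α := ℝ) p.2)]
  calc ((n + 1 : ℕ) : ℝ) * (a p.1 * a p.2) ^ 2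
      ≤ (p.1 + 1) * (p.2 + 1) * (a p.1 * a p.2) ^ 2 := by gcongr
    _ = b p.1 * b p.2 := by simp only [hb]; ring

theorem norm_coeff_mul_self_le (u : ℕ → ℂ) (n : ℕ) :
    ‖PowerSeries.coeff n (PowerSeries.mk u * PowerSeries.mk u)‖ ≤
      ∑ p ∈ antidiagonal n, ‖u p.1‖ * ‖u p.2‖ := by
  rw [PowerSeries.coeff_mul]
  refine (norm_sum_le _ _).trans_eq (sum_congr rfl fun p _ => ?_)
  simp

theorem summable_norm_sq_coeff_mul_self {u : ℕ → ℂ}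
    (hu : Summable fun n : ℕ => (n + 1 : ℝ) * ‖u n‖ ^ 2) :
    Summable fun n => ‖PowerSeries.coeff n (PowerSeries.mk u * PowerSeries.mk u)‖ ^ 2 :=
  (summable_sq_sum_antidiagonal hu).of_nonneg_of_le (fun _ => sq_nonneg _) fun n =>
    pow_le_pow_left₀ (norm_nonneg _) (norm_coeff_mul_self_le u n) 2

theorem summable_norm_sq_of_weighted {u : ℕ → ℂ}
    (hu : Summable fun n : ℕ => (n + 1 : ℝ) * ‖u n‖ ^ 2) : Summable fun n => ‖u n‖ ^ 2 :=
  hu.of_nonneg_of_le (fun _ => sq_nonneg _) fun n =>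
    le_mul_of_one_le_left (sq_nonneg _) (by linarith [Nat.cast_nonneg (α := ℝ) n])

theorem hasSum_ite_add_eq {E : Type*} [AddCommMonoid E] [TopologicalSpace E] (m : ℕ)
    (F : ℕ × ℕ → E) :
    HasSum (fun p : ℕ × ℕ => if p.1 + p.2 = m then F p else 0)
      (∑ p ∈ antidiagonal m, F p) := by
  have h : HasSum (fun p : ℕ × ℕ => if p.1 + p.2 = m then F p else 0)
      (∑ p ∈ antidiagonal m, if p.1 + p.2 = m then F p else 0) :=
    hasSum_sum_of_ne_finset_zero fun p hp =>
      if_neg fun h => hp (HasAntidiagonal.mem_antidiagonal.2 h)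
  rwa [sum_congr rfl fun p hp => if_pos (HasAntidiagonal.mem_antidiagonal.1 hp)] at h

theorem cubic_eq_hankel {u : ℕ → ℂ}
    (hu : Summable fun n : ℕ => (n + 1 : ℝ) * ‖u n‖ ^ 2) (n : ℕ) :
    cubic u n =
      hankel (fun m => PowerSeries.coeff m (PowerSeries.mk u * PowerSeries.mk u)) u n := by
  let e : ℕ × ℕ × ℕ ≃ ℕ × ℕ × ℕ :=
    ⟨fun x => (x.2.1, x.1, x.2.2), fun x => (x.2.1, x.1, x.2.2), fun _ => rfl, fun _ => rfl⟩
  let F : ℕ × ℕ × ℕ → ℂ := fun x =>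
    if x.2.1 + x.2.2 = x.1 + n then u x.2.1 * conj (u x.1) * u x.2.2 else 0
  have hnorm : ∀ q, HasSum (fun p => ‖F (q, p)‖)
      (‖u q‖ * ∑ p ∈ antidiagonal (q + n), ‖u p.1‖ * ‖u p.2‖) := by
    intro q
    have h := hasSum_ite_add_eq (q + n) fun p => ‖u p.1 * conj (u q) * u p.2‖
    rw [mul_sum]
    convert h using 2 with p
    · simp only [F, apply_ite norm, norm_zero]
    · rw [norm_mul, norm_mul, RCLike.norm_conj]; ring
  have hF : Summable F := by
    refine Summable.of_norm ((summable_prod_of_nonneg fun _ => norm_nonneg _).2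
      ⟨fun q => (hnorm q).summable, ?_⟩)
    simp_rw [fun q => (hnorm q).tsum_eq]
    have h1 := (summable_nat_add_iff n).2 (summable_sq_sum_antidiagonal hu)
    refine ((summable_norm_sq_of_weighted hu).add h1).of_nonneg_of_le
      (fun q => by positivity) fun q => ?_
    nlinarith [two_mul_le_add_sq ‖u q‖ (∑ p ∈ antidiagonal (q + n), ‖u p.1‖ * ‖u p.2‖),
      sq_nonneg ‖u q‖, sq_nonneg (∑ p ∈ antidiagonal (q + n), ‖u p.1‖ * ‖u p.2‖)]
  calc cubic u n = ∑' x, F x := (e.tsum_eq _).symm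
    _ = ∑' q, ∑' p, F (q, p) := hF.tsum_prod
    _ = _ := tsum_congr fun q => by
      rw [(hasSum_ite_add_eq (q + n) fun p => u p.1 * conj (u q) * u p.2).tsum_eq,
        add_comm q n]
      simp only [PowerSeries.coeff_mul, sum_mul]
      refine sum_congr rfl fun p _ => ?_
      simp only [PowerSeries.coeff_mk]
      ring

end Cubic

section Blaschke

open PowerSeries

theorem coeff_eq_of_eventually_hasSum {b c : ℕ → ℂ} {f : ℂ → ℂ}
    (hb : ∀ᶠ z in 𝓝 (0 : ℂ), HasSum (fun n => b n * z ^ n) (f z))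
    (hc : ∀ᶠ z in 𝓝 (0 : ℂ), HasSum (fun n => c n * z ^ n) (f z)) : b = c := by
  have key : ∀ {b : ℕ → ℂ}, (∀ᶠ z in 𝓝 (0 : ℂ), HasSum (fun n => b n * z ^ n) (f z)) →
      HasFPowerSeriesAt f (FormalMultilinearSeries.ofScalars ℂ b) 0 := by
    intro b hb
    rw [hasFPowerSeriesAt_iff]
    filter_upwards [hb] with z hz
    simpa [FormalMultilinearSeries.coeff_ofScalars, mul_comm] using hz
  funext n
  have h := (key hb).eq_formalMultilinearSeries (key hc)
  simpa [FormalMultilinearSeries.coeff_ofScalars] using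
    congrArg (fun p => FormalMultilinearSeries.coeff p n) h

theorem polynomial_hasSum (P : Polynomial ℂ) (z : ℂ) :
    HasSum (fun n => P.coeff n * z ^ n) (P.eval z) := by
  rw [Polynomial.eval_eq_sum_range]
  refine hasSum_sum_of_ne_finset_zero fun n hn => ?_
  rw [Polynomial.coeff_eq_zero_of_natDegree_lt (by simpa using hn), zero_mul]

theorem summable_norm_mul_pow_of_norm_lt {c : ℕ → ℂ} {w z : ℂ}
    (hw : Summable fun n => c n * w ^ n) (hz : ‖z‖ < ‖w‖) :
    Summable fun n => ‖c n * z ^ n‖ := by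
  have hw0 : 0 < ‖w‖ := (norm_nonneg z).trans_lt hz
  obtain ⟨C, hC⟩ := hw.tendsto_atTop_zero.norm.bddAbove_range
  have hg : Summable fun n => C * (‖z‖ / ‖w‖) ^ n :=
    (summable_geometric_of_lt_one (by positivity) ((div_lt_one hw0).2 hz)).mul_left C
  refine hg.of_nonneg_of_le (fun _ => norm_nonneg _) fun n => ?_
  have h1 : ‖c n * w ^ n‖ ≤ C := hC ⟨n, rfl⟩
  calc ‖c n * z ^ n‖ = ‖c n * w ^ n‖ * (‖z‖ / ‖w‖) ^ n := by
        rw [norm_mul, norm_mul, norm_pow, norm_pow, div_pow]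
        field_simp
    _ ≤ C * (‖z‖ / ‖w‖) ^ n := by gcongr

theorem hasSum_coeff_mul {D : Polynomial ℂ} {c : ℕ → ℂ} {z : ℂ}
    (hc : Summable fun n => ‖c n * z ^ n‖) :
    HasSum (fun n => coeff n ((D : PowerSeries ℂ) * PowerSeries.mk c) * z ^ n)
      (D.eval z * ∑' n, c n * z ^ n) := by
  have hD : Summable fun n => ‖D.coeff n * z ^ n‖ :=
    (polynomial_hasSum D z).summable.norm
  have h1 := (summable_norm_sum_mul_antidiagonal_of_summable_norm hD hc).of_norm.hasSum
  rw [← tsum_mul_tsum_eq_tsum_sum_antidiagonal_of_summable_norm hD hc,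
    (polynomial_hasSum D z).tsum_eq] at h1
  have hfun : (fun n => coeff n ((D : PowerSeries ℂ) * PowerSeries.mk c) * z ^ n) =
      fun n => ∑ p ∈ Finset.HasAntidiagonal.antidiagonal n,
        D.coeff p.1 * z ^ p.1 * (c p.2 * z ^ p.2) := by
    funext n
    rw [coeff_mul, Finset.sum_mul]
    refine Finset.sum_congr rfl fun p hp => ?_
    rw [← Finset.HasAntidiagonal.mem_antidiagonal.1 hp, pow_add, coeff_mk, Polynomial.coeff_coe]
    ring
  rw [hfun]
  exact h1

theorem mul_mk_eq_of_tsum_eq {P D : Polynomial ℂ} {c : ℕ → ℂ} (hP : P ≠ 0)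
    (hD : ∀ z : ℂ, ‖z‖ < 1 → D.eval z ≠ 0)
    (h : ∀ z : ℂ, ‖z‖ < 1 → ∑' n, c n * z ^ n = P.eval z / D.eval z) :
    (D : PowerSeries ℂ) * PowerSeries.mk c = P := by
  obtain ⟨w, hw, hw0, hPw⟩ : ∃ w : ℂ, ‖w‖ < 1 ∧ w ≠ 0 ∧ P.eval w ≠ 0 := by
    by_contra! hcon
    have hinf : (Metric.ball (0 : ℂ) 1 \ {0}).Infinite :=
      (infinite_of_mem_nhds (0 : ℂ) (Metric.ball_mem_nhds 0 one_pos)).sdiff (Set.finite_singleton 0)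
    refine hP (Polynomial.eq_zero_of_infinite_isRoot P (hinf.mono fun z hz => ?_))
    exact hcon z (by simpa using hz.1) hz.2
  have hsum : Summable fun n => c n * w ^ n := by
    by_contra hns
    have := h w hw
    rw [tsum_eq_zero_of_not_summable hns] at this
    exact div_ne_zero hPw (hD w hw) this.symm
  have hfun : (fun n => coeff n ((D : PowerSeries ℂ) * PowerSeries.mk c)) = P.coeff := by
    refine coeff_eq_of_eventually_hasSum (f := fun z => P.eval z) ?_
      (.of_forall fun z => polynomial_hasSum P z)
    filter_upwards [Metric.ball_mem_nhds (0 : ℂ) (norm_pos_iff.2 hw0)] with z hz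
    have hz' : ‖z‖ < ‖w‖ := by simpa using hz
    have := hasSum_coeff_mul (D := D) (summable_norm_mul_pow_of_norm_lt hsum hz')
    rwa [h z (hz'.trans hw), mul_div_cancel₀ _ (hD z (hz'.trans hw))] at this
  ext n
  rw [Polynomial.coeff_coe]
  exact congrFun hfun n

theorem reverse_map_conj_prod_X_sub_C (s : Multiset ℂ) :
    ((s.map fun a => Polynomial.X - Polynomial.C a).prod.map (starRingEnd ℂ)).reverse =
      (s.map fun a => 1 - Polynomial.C (conj a) * Polynomial.X).prod := by
  induction s using Multiset.induction with
  | empty => simpa using Polynomial.reverse_C (1 : ℂ)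
  | cons a s ih =>
    rw [Multiset.map_cons, Multiset.prod_cons, Polynomial.map_mul,
      Polynomial.reverse_mul_of_domain, ih, Multiset.map_cons, Multiset.prod_cons]
    congr 1
    rw [Polynomial.map_sub, Polynomial.map_X, Polynomial.map_C, Polynomial.reverse,
      Polynomial.natDegree_X_sub_C, Polynomial.reflect_sub, Polynomial.reflect_C, pow_one,
      Polynomial.reflect_one_X]

theorem exists_smoothInner_prod (s : Multiset ℂ) (hs : ∀ a ∈ s, ‖a‖ < 1) :
    ∃ b : PowerSeries ℂ, SmoothInner b ∧
      ((s.map fun a => 1 - Polynomial.C (conj a) * Polynomial.X).prod : Polynomial ℂ) * b =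
        ((s.map fun a => Polynomial.X - Polynomial.C a).prod : Polynomial ℂ) := by
  induction s using Multiset.induction with
  | empty =>
    exact ⟨1, by simpa using SmoothInner.C (c := 1) norm_one, by simp⟩
  | cons a s ih =>
    obtain ⟨b, hb, hb'⟩ := ih fun x hx => hs x (Multiset.mem_cons_of_mem hx)
    obtain ⟨c, hc, hc'⟩ := exists_smoothInner_factor (hs a (Multiset.mem_cons_self a s))
    refine ⟨c * b, hc.mul hb, ?_⟩
    simp only [Multiset.map_cons, Multiset.prod_cons, Polynomial.coe_mul, Polynomial.coe_sub,
      Polynomial.coe_one, Polynomial.coe_C, Polynomial.coe_X, ← hb', ← hc']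
    ring

theorem IsBlaschkeCoeff.smoothInner {χ : ℕ → ℂ} (hχ : IsBlaschkeCoeff χ) :
    SmoothInner (PowerSeries.mk χ) := by
  obtain ⟨k, ψ, P, hP, -, hroots, h⟩ := hχ
  have hPprod := (IsAlgClosed.splits P).eq_prod_roots_of_monic hP
  set D := (P.map (starRingEnd ℂ)).reverse with hDdef
  have hDprod : D =
      (P.roots.map fun a => 1 - Polynomial.C (conj a) * Polynomial.X).prod := by
    rw [← reverse_map_conj_prod_X_sub_C, ← hPprod]
  set c := Complex.exp (-(ψ : ℂ) * Complex.I) with hc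
  have hc1 : ‖c‖ = 1 := by
    rw [hc, ← Complex.ofReal_neg, Complex.norm_exp_ofReal_mul_I]
  have hc0 : c ≠ 0 := Complex.exp_ne_zero _
  have hD : ∀ z : ℂ, ‖z‖ < 1 → D.eval z ≠ 0 := by
    intro z hz
    rw [hDprod, Polynomial.eval_multiset_prod, Multiset.map_map]
    refine Multiset.prod_ne_zero fun h0 => ?_
    obtain ⟨a, ha, ha0⟩ := Multiset.mem_map.1 h0
    simp only [Function.comp_apply, Polynomial.eval_sub, Polynomial.eval_one,
      Polynomial.eval_mul, Polynomial.eval_C, Polynomial.eval_X, sub_eq_zero] at ha0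
    have h1 : ‖conj a * z‖ < 1 := by
      rw [norm_mul, RCLike.norm_conj]
      exact mul_lt_one_of_nonneg_of_lt_one_left (norm_nonneg _) (hroots a ha) hz.le
    rw [← ha0, norm_one] at h1
    exact lt_irrefl _ h1
  have hmul := mul_mk_eq_of_tsum_eq (P := Polynomial.C c * P)
    (mul_ne_zero (Polynomial.C_ne_zero.2 hc0) hP.ne_zero) hD
    (fun z hz => by rw [h z hz, Polynomial.eval_mul, Polynomial.eval_C])
  obtain ⟨b, hb, hb'⟩ := exists_smoothInner_prod P.roots hroots
  rw [← hPprod, ← hDprod] at hb'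
  have hD0 : (D : PowerSeries ℂ) ≠ 0 := by
    intro h0
    rw [Polynomial.coe_eq_zero_iff] at h0
    exact hD 0 (by simp) (by simp [h0])
  have : PowerSeries.mk χ = PowerSeries.C c * b := by
    apply mul_left_cancel₀ hD0
    rw [hmul, Polynomial.coe_mul, Polynomial.coe_C, ← hb']
    ring
  rw [this]
  exact (SmoothInner.C hc1).mul hb

end Blaschke

section SubstSeq

open PowerSeries

theorem mulSeq_eq_coeff (b c : ℕ → ℂ) (n : ℕ) :
    mulSeq b c n = coeff n (PowerSeries.mk b * PowerSeries.mk c) := by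
  rw [coeff_mul, Finset.Nat.sum_antidiagonal_eq_sum_range_succ_mk]
  simp [mulSeq]

theorem mk_powSeq (b : ℕ → ℂ) (n : ℕ) : PowerSeries.mk (powSeq b n) = PowerSeries.mk b ^ n := by
  induction n with
  | zero =>
    ext m
    simp [powSeq, oneSeq, coeff_one]
  | succ n ih =>
    rw [pow_succ', ← ih]
    ext m
    rw [← mulSeq_eq_coeff, coeff_mk, powSeq, Function.iterate_succ_apply', powSeq]

theorem mk_shiftSeq (χ : ℕ → ℂ) : PowerSeries.mk (shiftSeq χ) = X * PowerSeries.mk χ := by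
  ext n
  cases n with
  | zero => simp [shiftSeq]
  | succ n => simp [shiftSeq, coeff_succ_X_mul]

theorem constantCoeff_mk_shiftSeq (χ : ℕ → ℂ) :
    constantCoeff (PowerSeries.mk (shiftSeq χ)) = 0 := by
  simp [mk_shiftSeq]

theorem substSeq_eq_coeff (χ u : ℕ → ℂ) (m : ℕ) :
    substSeq χ u m = coeff m ((PowerSeries.mk u).subst (PowerSeries.mk (shiftSeq χ))) := by
  rw [coeff_subst_eq_tsum (constantCoeff_mk_shiftSeq χ)]
  simp [substSeq, ← mk_powSeq]

theorem substSeq_eq_sum (χ u : ℕ → ℂ) (m : ℕ) :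
    substSeq χ u m = ∑ n ∈ Finset.range (m + 1), u n * powSeq (shiftSeq χ) n m := by
  rw [substSeq_eq_coeff, coeff_subst_eq_sum (constantCoeff_mk_shiftSeq χ) _ m.lt_succ_self]
  simp [← mk_powSeq]

theorem subst_injective {a : PowerSeries ℂ} (ha : a ≠ 0) (ha0 : constantCoeff a = 0) :
    Function.Injective fun f : PowerSeries ℂ => f.subst a := by
  have hs : HasSubst a := .of_constantCoeff_zero' ha0
  have h : Function.Injective (substAlgHom (R := ℂ) hs) := by
    rw [injective_iff_map_eq_zero]
    intro f hf
    by_contra hf0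
    rw [← X_pow_order_mul_divXPowOrder (f := f), map_mul, map_pow, substAlgHom_X] at hf
    refine (mul_ne_zero (pow_ne_zero _ ha) fun h0 => coeff_order hf0 ?_) hf
    have h1 := congrArg (coeff 0) h0
    rw [coe_substAlgHom, coeff_subst_eq_sum ha0 _ zero_lt_one] at h1
    simpa [constantCoeff_divXPowOrder] using h1
  simpa [coe_substAlgHom] using h

theorem MemHs.summable_weighted {s : ℝ} (hs : 1 / 2 < s) {u : ℕ → ℂ} (hu : MemHs s u) :
    Summable fun n : ℕ => (n + 1 : ℝ) * ‖u n‖ ^ 2 := by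
  refine (hu.mul_left 2).of_nonneg_of_le (fun n => by positivity) fun n => ?_
  have h1 : (1 : ℝ) ≤ 1 + (n : ℝ) ^ 2 := by nlinarith [sq_nonneg (n : ℝ)]
  have h2 : (n + 1 : ℝ) ≤ 2 * (1 + (n : ℝ) ^ 2) ^ s := by
    have h3 : (1 + (n : ℝ) ^ 2) ^ (1 / 2 : ℝ) ≤ (1 + (n : ℝ) ^ 2) ^ s :=
      Real.rpow_le_rpow_of_exponent_le h1 hs.le
    rw [← Real.sqrt_eq_rpow] at h3
    have h4 : (n : ℝ) ≤ √(1 + (n : ℝ) ^ 2) := Real.le_sqrt_of_sq_le (by linarith)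
    have h5 : 1 ≤ √(1 + (n : ℝ) ^ 2) := Real.one_le_sqrt.2 h1
    linarith
  calc (n + 1 : ℝ) * ‖u n‖ ^ 2 ≤ (2 * (1 + (n : ℝ) ^ 2) ^ s) * ‖u n‖ ^ 2 := by gcongr
    _ = _ := by ring

theorem cubic_coeff_subst {a : PowerSeries ℂ} (ha : SmoothInner a) (ha0 : constantCoeff a = 0)
    {u : ℕ → ℂ} (hu : Summable fun n : ℕ => (n + 1 : ℝ) * ‖u n‖ ^ 2) (k : ℕ) :
    cubic (fun m => coeff m ((PowerSeries.mk u).subst a)) k =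
      coeff k ((PowerSeries.mk (cubic u)).subst a) := by
  obtain ⟨V, hV⟩ := exists_subst_isometry ha.1 ha0
  let g : Hardy := ⟨u, memLp_two_of_summable (summable_norm_sq_of_weighted hu)⟩
  let w : Hardy := ⟨_, memLp_two_of_summable (summable_norm_sq_coeff_mul_self hu)⟩
  have hg : toSeries g = PowerSeries.mk u := rfl
  have hw : toSeries w = PowerSeries.mk u * PowerSeries.mk u := by
    ext n
    rw [coeff_toSeries]
  have hVg : (fun m => coeff m ((PowerSeries.mk u).subst a)) = V g := by
    funext m
    rw [← hg, ← hV, coeff_toSeries]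
  have hVw : (fun m => coeff m (PowerSeries.mk (V g) * PowerSeries.mk (V g))) = V w := by
    funext m
    rw [← coeff_toSeries m (V w), hV, hw, subst_mul (.of_constantCoeff_zero' ha0), ← hg, ← hV]
    rfl
  have hu' : Summable fun n : ℕ => (n + 1 : ℝ) * ‖V g n‖ ^ 2 := by
    have h1 := summable_coeff_subst ha ha0 (u := u) (hu.of_nonneg_of_le
      (fun n => by positivity) fun n => by gcongr; linarith)
    refine (h1.add (hardy_hasSum_norm_sq (V g)).summable).congr fun n => ?_
    rw [← hVg]
    ring
  rw [hVg, cubic_eq_hankel hu', hVw, hankel_subst_eq ha.1 ha0 hV,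
    funext (cubic_eq_hankel hu)]

theorem SmoothInner.ne_zero {a : PowerSeries ℂ} (ha : SmoothInner a) : a ≠ 0 := by
  rintro rfl
  obtain ⟨⟨M, hM⟩, -⟩ := ha
  have h : M oneH = M 0 := hardy_ext (by rw [hM, hM, zero_mul, zero_mul])
  have h1 := congrArg toSeries (M.injective h)
  rw [toSeries_oneH, map_zero] at h1
  exact one_ne_zero h1

end SubstSeq

/-- For a time-independent finite Blaschke product `χ`, `u` solves the
α-Szegő equation if and only if `ũ(t,z) := u(t, zχ(z))` solves the α-Szegő equation. -/
theorem alphaSzego_blaschke_substitution (α s : ℝ) (hs : 1/2 < s)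
    (χ : ℕ → ℂ) (hχ : IsBlaschkeCoeff χ)
    (u : ℝ → ℕ → ℂ) (hreg : SmoothHsCurve s u) :
    SolvesSzego α u ↔ SolvesSzego α fun t => substSeq χ (u t) := by
  have hΘ : SmoothInner (PowerSeries.mk (shiftSeq χ)) := by
    rw [mk_shiftSeq]
    exact SmoothInner.X.mul hχ.smoothInner
  have hΘ0 := constantCoeff_mk_shiftSeq χ
  have hcubic : ∀ t m, cubic (substSeq χ (u t)) m = substSeq χ (cubic (u t)) m := by
    intro t m
    rw [funext (substSeq_eq_coeff χ (u t)), substSeq_eq_coeff,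
      cubic_coeff_subst hΘ hΘ0 ((hreg.1 t).summable_weighted hs)]
  have hzero : ∀ t, substSeq χ (u t) 0 = u t 0 := fun t => by
    simp [substSeq_eq_sum, powSeq, oneSeq]
  have hrhs : ∀ t m, -Complex.I * (cubic (substSeq χ (u t)) m +
        (α : ℂ) * substSeq χ (u t) 0 * oneSeq m) =
      substSeq χ (fun n => -Complex.I * (cubic (u t) n + (α : ℂ) * u t 0 * oneSeq n)) m := by
    intro t m
    rw [hcubic, hzero, substSeq_eq_sum, substSeq_eq_sum]
    have h1 : oneSeq m =
        ∑ n ∈ Finset.range (m + 1), oneSeq n * powSeq (shiftSeq χ) n m := by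
      rw [Finset.sum_eq_single_of_mem 0 (by simp) fun n _ hn => by simp [oneSeq, hn]]
      simp [powSeq, oneSeq]
    rw [h1, Finset.mul_sum, ← Finset.sum_add_distrib, Finset.mul_sum]
    exact Finset.sum_congr rfl fun n _ => by ring
  have hderiv : ∀ {v : ℕ → ℂ} {t : ℝ}, (∀ n, HasDerivAt (fun τ => u τ n) (v n) t) →
      ∀ m, HasDerivAt (fun τ => substSeq χ (u τ) m) (substSeq χ v m) t := by
    intro v t hv m
    simp_rw [substSeq_eq_sum]
    exact HasDerivAt.fun_sum fun n _ => (hv n).mul_const _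
  constructor
  · intro h m t
    rw [hrhs]
    exact hderiv (fun n => h n t) m
  · intro h n t
    have hd : ∀ n, HasDerivAt (fun τ => u τ n) (deriv (fun τ => u τ n) t) t := fun n =>
      ((hreg.2 n).differentiable (by simp) t).hasDerivAt
    have heq : PowerSeries.mk (fun n => deriv (fun τ => u τ n) t) = PowerSeries.mk
        (fun n => -Complex.I * (cubic (u t) n + (α : ℂ) * u t 0 * oneSeq n)) := by
      apply subst_injective hΘ.ne_zero hΘ0
      ext m
      rw [← substSeq_eq_coeff, ← substSeq_eq_coeff, ← hrhs]
      exact (hderiv hd m).unique (h m t)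
    have hn := congrArg (PowerSeries.coeff n) heq
    rw [PowerSeries.coeff_mk, PowerSeries.coeff_mk] at hn
    rw [← hn]
    exact hd n

end
end
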